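/- arXiv:0811.2735 — 3 statements merged into one kernel-verified Lean document; each statement's English description precedes it below -/
import Mathlib

section
/- For x ∈ Ω with all coordinates strictly positive and n x ∈ ℕ^q, define r_{β,h,n}(x) by Z_{β,h,n} · μ_{β,h,n}(N = n x) = (1 + r_{β,h,n}(x)) · n^{−(q−1)/2} · A_β(x) · exp(−n f_{β,h}(x)), where A_β(x) = (2π)^{−(q−1)/2} (∏_{i=1}^q x_i^{−1/2}) e^{−β/2}. Then for every ε > 0, sup_{x ∈ Ω_ε^n} sup_{β,h ≥ 0} |r_{β,h,n}(x)| → 0 as n → ∞, where Ω_ε^n = {x ∈ Ω : min_i x_i ≥ ε and n x ∈ ℕ^q}. -/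
open Real Filter Finset Topology MeasureTheory

/-- The simplex `Ω = {x ∈ ℝ^q : x_1 + ⋯ + x_q = 1, x_i ≥ 0}`. -/
def simplex (q : ℕ) : Set (Fin q → ℝ) := {x | (∀ i, 0 ≤ x i) ∧ ∑ i, x i = 1}

/-- The Curie–Weiss Potts free energy
`f_{β,h}(x) = ∑ x_i log x_i − (β/2) ∑ x_i² − h x_1` (with `0 log 0 = 0`). -/
noncomputable def freeEnergy (q : ℕ) [NeZero q] (β h : ℝ) (x : Fin q → ℝ) : ℝ :=
  ∑ i, x i * Real.log (x i) - β / 2 * ∑ i, x i ^ 2 - h * x 0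

/-- Boltzmann weight of a spin configuration `σ : Fin n → Fin q`:
`exp((β/n) ∑_{i<j} δ_{σ_i,σ_j} + h ∑_i δ_{σ_i,1})`. -/
noncomputable def cwWeight (q n : ℕ) [NeZero q] (β h : ℝ) (σ : Fin n → Fin q) : ℝ :=
  Real.exp (β / n *
      ∑ p ∈ Finset.univ.filter (fun p : Fin n × Fin n => p.1 < p.2),
        (if σ p.1 = σ p.2 then (1 : ℝ) else 0)
    + h * ∑ i, (if σ i = 0 then (1 : ℝ) else 0))

/-- The partition function `Z_{β,h,n}`. -/
noncomputable def cwZ (q n : ℕ) [NeZero q] (β h : ℝ) : ℝ :=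
  ∑ σ : Fin n → Fin q, cwWeight q n β h σ

/-- The empirical color count `N_k(σ) = #{i : σ_i = k}`. -/
def colorCount {q n : ℕ} (σ : Fin n → Fin q) (k : Fin q) : ℕ :=
  (Finset.univ.filter (fun i => σ i = k)).card

/-- Probability of an event under the Curie–Weiss Potts measure `μ_{β,h,n}`. -/
noncomputable def cwProb (q n : ℕ) [NeZero q] (β h : ℝ) (A : Set (Fin n → Fin q)) : ℝ :=
  (∑ σ : Fin n → Fin q, Set.indicator A (cwWeight q n β h) σ) / cwZ q n β h

/-- Expectation of an observable under the Curie–Weiss Potts measure `μ_{β,h,n}`. -/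
noncomputable def cwExp (q n : ℕ) [NeZero q] (β h : ℝ) (g : (Fin n → Fin q) → ℝ) : ℝ :=
  (∑ σ : Fin n → Fin q, cwWeight q n β h σ * g σ) / cwZ q n β h

/-- The prefactor `A_β(x) = (2π)^{−(q−1)/2} ∏ x_i^{−1/2} e^{−β/2}`. -/
noncomputable def Apref (q : ℕ) (β : ℝ) (x : Fin q → ℝ) : ℝ :=
  (2 * Real.pi) ^ (-(((q : ℝ) - 1) / 2)) * (∏ i, x i ^ (-(1 / 2 : ℝ))) * Real.exp (-β / 2)

theorem sum_colorCount {q n : ℕ} (σ : Fin n → Fin q) : ∑ k, colorCount σ k = n := by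
  simpa [colorCount] using
    (Finset.card_eq_sum_card_fiberwise (s := Finset.univ) (t := Finset.univ) (f := σ)
      (fun i _ => Finset.mem_coe.2 (Finset.mem_univ (σ i)))).symm

theorem sum_pairs_ite_eq_sum_sq_colorCount {q n : ℕ} (σ : Fin n → Fin q) :
    ∑ p : Fin n × Fin n, (if σ p.1 = σ p.2 then (1 : ℝ) else 0)
      = ∑ k, (colorCount σ k : ℝ) ^ 2 := by
  have h : ∀ i j, (if σ i = σ j then (1 : ℝ) else 0)
      = ∑ k, (if σ i = k then (1 : ℝ) else 0) * (if σ j = k then (1 : ℝ) else 0) := by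
    intro i j
    simp [eq_comm]
  rw [Fintype.sum_prod_type]
  simp_rw [h]
  rw [Finset.sum_congr rfl fun i _ => Finset.sum_comm, Finset.sum_comm]
  refine Finset.sum_congr rfl fun k _ => ?_
  rw [← Finset.sum_mul_sum]
  simp [colorCount, sq]

theorem sum_lt_pairs_ite_eq {q n : ℕ} (σ : Fin n → Fin q) :
    ∑ p ∈ Finset.univ.filter (fun p : Fin n × Fin n => p.1 < p.2),
        (if σ p.1 = σ p.2 then (1 : ℝ) else 0)
      = (∑ k, (colorCount σ k : ℝ) ^ 2 - n) / 2 := by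
  rw [← sum_pairs_ite_eq_sum_sq_colorCount]
  have hswap : ∑ p : Fin n × Fin n,
        (if p.2 < p.1 then (if σ p.1 = σ p.2 then (1 : ℝ) else 0) else 0)
      = ∑ p : Fin n × Fin n,
        (if p.1 < p.2 then (if σ p.1 = σ p.2 then (1 : ℝ) else 0) else 0) :=
    Fintype.sum_equiv (Equiv.prodComm _ _) _ _ fun p => by simp [eq_comm]
  have hdiag : ∑ p : Fin n × Fin n,
      (if p.1 = p.2 then (if σ p.1 = σ p.2 then (1 : ℝ) else 0) else 0) = n := by
    simp [Fintype.sum_prod_type]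
  have hsplit : ∑ p : Fin n × Fin n, (if σ p.1 = σ p.2 then (1 : ℝ) else 0)
      = ∑ p : Fin n × Fin n,
          (if p.1 < p.2 then (if σ p.1 = σ p.2 then (1 : ℝ) else 0) else 0)
        + ∑ p : Fin n × Fin n,
          (if p.2 < p.1 then (if σ p.1 = σ p.2 then (1 : ℝ) else 0) else 0)
        + ∑ p : Fin n × Fin n,
          (if p.1 = p.2 then (if σ p.1 = σ p.2 then (1 : ℝ) else 0) else 0) := by
    rw [← Finset.sum_add_distrib, ← Finset.sum_add_distrib]
    refine Finset.sum_congr rfl fun p _ => ?_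
    rcases lt_trichotomy p.1 p.2 with h | h | h
    · simp [h, h.ne, h.not_gt]
    · simp [h]
    · simp [h, h.ne', h.not_gt]
  rw [Finset.sum_filter]
  linarith

theorem cwWeight_eq (q n : ℕ) [NeZero q] (β h : ℝ) (σ : Fin n → Fin q) :
    cwWeight q n β h σ
      = Real.exp (β / n * ((∑ k, (colorCount σ k : ℝ) ^ 2 - n) / 2) + h * colorCount σ 0) := by
  rw [cwWeight, sum_lt_pairs_ite_eq]
  simp [colorCount]

theorem card_filter_colorCount_eq_multinomial {q n : ℕ} (m : Fin q → ℕ) (hm : ∑ k, m k = n) :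
    (Finset.univ.filter fun σ : Fin n → Fin q => colorCount σ = m).card
      = Nat.multinomial Finset.univ m := by
  have hprod : ∀ σ : Fin n → Fin q,
      ∏ i, (MvPolynomial.X (σ i) : MvPolynomial (Fin q) ℕ)
        = ∏ k, MvPolynomial.X k ^ colorCount σ k := by
    intro σ
    rw [← Finset.prod_fiberwise (s := Finset.univ) (g := σ)]
    refine Finset.prod_congr rfl fun k _ => ?_
    rw [Finset.prod_congr rfl fun i hi => by rw [(Finset.mem_filter.1 hi).2]]
    simp [colorCount]
  have hcoeff : ∀ k : Fin q → ℕ, MvPolynomial.coeff (Finsupp.equivFunOnFinite.symm m)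
      (∏ y, (MvPolynomial.X y : MvPolynomial (Fin q) ℕ) ^ k y) = if k = m then 1 else 0 := by
    intro k
    rw [MvPolynomial.coeff_prod_X_pow]
    refine if_congr ?_ rfl rfl
    rw [Finsupp.ext_iff, funext_iff]
    simp [eq_comm]
  have key := congrArg (MvPolynomial.coeff (Finsupp.equivFunOnFinite.symm m))
    ((Finset.sum_pow' Finset.univ (fun k : Fin q => (MvPolynomial.X k : MvPolynomial (Fin q) ℕ))
      n).symm.trans (Finset.sum_pow_eq_sum_piAntidiag _ _ n))
  simp only [hprod, MvPolynomial.coeff_sum, Fintype.piFinset_univ, hcoeff,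
    ← MvPolynomial.C_eq_coe_nat, MvPolynomial.coeff_C_mul] at key
  rw [Finset.card_filter, key, Finset.sum_eq_single m]
  · simp
  · intro k _ hk
    simp [hk]
  · simp [hm]

theorem factorial_eq_stirlingSeq_mul {n : ℕ} (hn : n ≠ 0) :
    (n.factorial : ℝ) = Stirling.stirlingSeq n * (√(2 * n) * (n / Real.exp 1) ^ n) := by
  have : (0 : ℝ) < n := by positivity
  rw [Stirling.stirlingSeq, div_mul_cancel₀]
  positivity

theorem prod_nat_mul_pow_eq {q n : ℕ} {m : Fin q → ℕ} {x : Fin q → ℝ}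
    (hx : ∀ i, 0 < x i) (hm : ∀ i, (m i : ℝ) = n * x i) (hsum : ∑ i, m i = n) :
    ∏ i, ((m i : ℝ) / Real.exp 1) ^ m i
      = (n / Real.exp 1) ^ n * Real.exp (n * ∑ i, x i * Real.log (x i)) := by
  have h : ∀ i, ((m i : ℝ) / Real.exp 1) ^ m i
      = ((n : ℝ) / Real.exp 1) ^ m i * Real.exp (n * (x i * Real.log (x i))) := by
    intro i
    have : Real.exp (n * (x i * Real.log (x i))) = x i ^ m i := by
      rw [← mul_assoc, ← hm, Real.exp_nat_mul, Real.exp_log (hx i)]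
    rw [this, ← mul_pow, hm]
    ring
  rw [Finset.prod_congr rfl fun i _ => h i, Finset.prod_mul_distrib, Finset.prod_pow_eq_pow_sum,
    hsum, ← Real.exp_sum, Finset.mul_sum]

theorem prod_sqrt_two_mul {q n : ℕ} (hn : n ≠ 0) {x : Fin q → ℝ} (hx : ∀ i, 0 < x i) :
    √(2 * n) * ((n : ℝ) ^ (((q : ℝ) - 1) / 2) * (2 * Real.pi) ^ (((q : ℝ) - 1) / 2))
      = (∏ i, √(2 * (n * x i))) * (∏ i, x i ^ (-(1 / 2 : ℝ))) * (√Real.pi ^ q / √Real.pi) := by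
  have hn' : (0 : ℝ) < n := by positivity
  have h : ∀ i, √(2 * (n * x i)) * x i ^ (-(1 / 2 : ℝ)) = √(2 * n) := by
    intro i
    have : 0 < √(x i) := Real.sqrt_pos.2 (hx i)
    rw [Real.rpow_neg (hx i).le, ← Real.sqrt_eq_rpow, ← mul_assoc, Real.sqrt_mul (by positivity)]
    field_simp
  have hpow : ∀ a : ℝ, 0 < a → a ^ (((q : ℝ) - 1) / 2) = √a ^ q / √a := by
    intro a ha
    have : 0 < √a := Real.sqrt_pos.2 ha
    rw [← Real.rpow_natCast, ← Real.rpow_sub_one this.ne', Real.sqrt_eq_rpow, ← Real.rpow_mul ha.le]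
    ring_nf
  rw [← Finset.prod_mul_distrib, Finset.prod_congr rfl fun i _ => h i, hpow _ hn',
    hpow _ (by positivity), Real.sqrt_mul (by positivity), Real.sqrt_mul (by positivity)]
  have : 0 < √(n : ℝ) := Real.sqrt_pos.2 hn'
  have : 0 < √Real.pi := Real.sqrt_pos.2 Real.pi_pos
  simp only [Finset.prod_const, Finset.card_univ, Fintype.card_fin]
  field_simp
  ring

theorem multinomial_eq_stirlingSeq {q n : ℕ} (hn : n ≠ 0) {m : Fin q → ℕ} {x : Fin q → ℝ}
    (hx : ∀ i, 0 < x i) (hm : ∀ i, (m i : ℝ) = n * x i) (hsum : ∑ i, m i = n) :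
    (Nat.multinomial Finset.univ m : ℝ)
      = (Stirling.stirlingSeq n / √Real.pi) / (∏ i, Stirling.stirlingSeq (m i) / √Real.pi)
        * ((n : ℝ) ^ (-(((q : ℝ) - 1) / 2)) * ((2 * Real.pi) ^ (-(((q : ℝ) - 1) / 2))
          * ∏ i, x i ^ (-(1 / 2 : ℝ))) * Real.exp (-(n * ∑ i, x i * Real.log (x i)))) := by
  have hn' : (0 : ℝ) < n := by positivity
  have hm0 : ∀ i, m i ≠ 0 := fun i hi => by
    have := hm i
    rw [hi] at this
    have := mul_pos hn' (hx i)
    simp_all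
  have hS : ∀ {k : ℕ}, k ≠ 0 → 0 < Stirling.stirlingSeq k := fun hk =>
    (Real.sqrt_pos.2 Real.pi_pos).trans_le (Stirling.sqrt_pi_le_stirlingSeq hk)
  have hspec : (∏ i, ((m i).factorial : ℝ)) * Nat.multinomial Finset.univ m = n.factorial := by
    have := Nat.multinomial_spec Finset.univ m
    rw [hsum] at this
    exact_mod_cast this
  rw [Finset.prod_congr rfl fun i _ => factorial_eq_stirlingSeq_mul (hm0 i),
    Finset.prod_mul_distrib, Finset.prod_mul_distrib, prod_nat_mul_pow_eq hx hm hsum,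
    factorial_eq_stirlingSeq_mul hn] at hspec
  simp_rw [hm] at hspec
  have hroot := prod_sqrt_two_mul hn hx
  have hpi : 0 < √Real.pi := Real.sqrt_pos.2 Real.pi_pos
  have h1 : 0 < ∏ i, Stirling.stirlingSeq (m i) := Finset.prod_pos fun i _ => hS (hm0 i)
  have h2 : 0 < ∏ i, √(2 * (n * x i)) := Finset.prod_pos fun i _ => by
    have := hx i
    positivity
  have h3 : 0 < (n / Real.exp 1) ^ n := by positivity
  have h4 : 0 < (n : ℝ) ^ (((q : ℝ) - 1) / 2) := by positivity
  have h5 : 0 < (2 * Real.pi) ^ (((q : ℝ) - 1) / 2) := by positivity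
  rw [Real.rpow_neg hn'.le, Real.rpow_neg (by positivity), Real.exp_neg, Finset.prod_div_distrib]
  simp only [Finset.prod_const, Finset.card_univ, Fintype.card_fin]
  generalize (n : ℝ) ^ (((q : ℝ) - 1) / 2) = a at *
  generalize (2 * Real.pi) ^ (((q : ℝ) - 1) / 2) = b at *
  have h6 := Real.exp_pos (n * ∑ i, x i * Real.log (x i))
  generalize Real.exp (n * ∑ i, x i * Real.log (x i)) = E at *
  generalize ∏ i, x i ^ (-(1 / 2 : ℝ)) = P at *
  generalize ∏ i, √(2 * (n * x i)) = Q at *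
  generalize (n / Real.exp 1) ^ n = W at *
  generalize ∏ i, Stirling.stirlingSeq (m i) = S at *
  have hspec' : S * Q * E * Nat.multinomial Finset.univ m
      = Stirling.stirlingSeq n * √(2 * n) :=
    mul_right_cancel₀ h3.ne' (by linear_combination hspec)
  field_simp at hroot ⊢
  refine mul_right_cancel₀ h2.ne' ?_
  linear_combination (a * b * √Real.pi) * hspec' + Stirling.stirlingSeq n * hroot

theorem tendsto_stirlingSeq_div_sqrt_pi :
    Tendsto (fun n => Stirling.stirlingSeq n / √Real.pi) atTop (𝓝 1) := by
  have hpi : √Real.pi ≠ 0 := (Real.sqrt_pos.2 Real.pi_pos).ne'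
  simpa [hpi] using Stirling.tendsto_stirlingSeq_sqrt_pi.div_const (√Real.pi)

theorem exists_stirlingSeq_ratio_close (q : ℕ) {δ : ℝ} (hδ : 0 < δ) :
    ∃ M : ℕ, ∀ n ≥ M, ∀ m : Fin q → ℕ, (∀ i, M ≤ m i) →
      |(Stirling.stirlingSeq n / √Real.pi) / (∏ i, Stirling.stirlingSeq (m i) / √Real.pi) - 1|
        ≤ δ := by
  have hcont : ContinuousAt (fun p : ℝ × (Fin q → ℝ) => p.1 / ∏ i, p.2 i) (1, fun _ => 1) := by
    refine ContinuousAt.div (by fun_prop) (by fun_prop) (by simp)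
  obtain ⟨η, hη, hball⟩ := Metric.continuousAt_iff.1 hcont δ hδ
  obtain ⟨M, hM⟩ := Metric.tendsto_atTop.1 tendsto_stirlingSeq_div_sqrt_pi η hη
  refine ⟨M, fun n hn m hm => ?_⟩
  have := @hball (Stirling.stirlingSeq n / √Real.pi,
    fun i => Stirling.stirlingSeq (m i) / √Real.pi)
    (by
      rw [Prod.dist_eq, max_lt_iff]
      exact ⟨hM n hn, (dist_pi_lt_iff hη).2 fun i => hM _ (hm i)⟩)
  simpa [Real.dist_eq] using this.le

theorem sum_indicator_cwWeight_eq (q n : ℕ) [NeZero q] (β h : ℝ) {m : Fin q → ℕ}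
    {x : Fin q → ℝ} (hm : ∀ i, (m i : ℝ) = n * x i) (hsum : ∑ i, m i = n) :
    ∑ σ : Fin n → Fin q,
        Set.indicator {σ' : Fin n → Fin q | ∀ k, (colorCount σ' k : ℝ) = n * x k}
          (cwWeight q n β h) σ
      = Nat.multinomial Finset.univ m
        * Real.exp (β / n * ((∑ k, (n * x k) ^ 2 - n) / 2) + h * (n * x 0)) := by
  have hset : ∀ σ : Fin n → Fin q,
      Set.indicator {σ' : Fin n → Fin q | ∀ k, (colorCount σ' k : ℝ) = n * x k}
        (cwWeight q n β h) σ
      = if colorCount σ = m then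
          Real.exp (β / n * ((∑ k, (n * x k) ^ 2 - n) / 2) + h * (n * x 0)) else 0 := by
    intro σ
    have hiff : σ ∈ {σ' : Fin n → Fin q | ∀ k, (colorCount σ' k : ℝ) = n * x k}
        ↔ colorCount σ = m := by
      simp_rw [Set.mem_ofPred_eq, ← hm, Nat.cast_inj, funext_iff]
    by_cases hσ : colorCount σ = m
    · rw [Set.indicator_of_mem (hiff.2 hσ), if_pos hσ, cwWeight_eq, hσ]
      simp_rw [hm]
    · rw [Set.indicator_of_notMem (mt hiff.1 hσ), if_neg hσ]
  rw [Finset.sum_congr rfl fun σ _ => hset σ, ← Finset.sum_filter, Finset.sum_const,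
    card_filter_colorCount_eq_multinomial m hsum, nsmul_eq_mul]

/-- Stirling approximation of the density: with
`Z_{β,h,n} μ_{β,h,n}(N = nx) = (1+r_{β,h,n}(x)) n^{−(q−1)/2} A_β(x) e^{−n f_{β,h}(x)}`,
the error `r` tends to `0` uniformly over `x ∈ Ω_ε^n` and `β, h ≥ 0`. -/
theorem stmt_10 (q : ℕ) [NeZero q] (hq : 2 ≤ q) (ε : ℝ) (hε : 0 < ε) :
    ∀ δ > (0 : ℝ), ∃ n₀ : ℕ, ∀ n ≥ n₀, ∀ β : ℝ, 0 ≤ β → ∀ h : ℝ, 0 ≤ h →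
      ∀ x ∈ simplex q, (∀ i, ε ≤ x i) → (∀ i, ∃ m : ℕ, (m : ℝ) = n * x i) →
      |(∑ σ : Fin n → Fin q,
            Set.indicator {σ' : Fin n → Fin q | ∀ k, (colorCount σ' k : ℝ) = n * x k}
              (cwWeight q n β h) σ)
          / ((n : ℝ) ^ (-(((q : ℝ) - 1) / 2)) * Apref q β x
              * Real.exp (-(n : ℝ) * freeEnergy q β h x)) - 1| ≤ δ := by
  intro δ hδ
  obtain ⟨M, hM⟩ := exists_stirlingSeq_ratio_close q hδ
  obtain ⟨n₀, hn₀⟩ := exists_nat_ge ((M : ℝ) / ε)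
  refine ⟨max (max n₀ M) 1, fun n hn β _ h _ x hx hεx hint => ?_⟩
  simp only [ge_iff_le, max_le_iff] at hn
  obtain ⟨⟨hnn₀, hnM⟩, hn1⟩ := hn
  have hn0 : n ≠ 0 := by omega
  have hn' : (0 : ℝ) < n := by positivity
  have hxpos : ∀ i, 0 < x i := fun i => hε.trans_le (hεx i)
  choose m hm using hint
  have hsum : ∑ i, m i = n := by
    have : (∑ i, (m i : ℝ)) = n := by
      rw [Finset.sum_congr rfl fun i _ => hm i, ← Finset.mul_sum, hx.2, mul_one]
    exact_mod_cast this
  have hmM : ∀ i, M ≤ m i := by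
    intro i
    have h1 : (M : ℝ) ≤ n * ε := (div_le_iff₀ hε).1 (hn₀.trans (by exact_mod_cast hnn₀))
    have h2 : (M : ℝ) ≤ m i := by
      rw [hm]
      exact h1.trans (mul_le_mul_of_nonneg_left (hεx i) hn'.le)
    exact_mod_cast h2
  have hP : 0 < ∏ i, x i ^ (-(1 / 2 : ℝ)) :=
    Finset.prod_pos fun i _ => Real.rpow_pos_of_pos (hxpos i) _
  have hexp : Real.exp (-(n * ∑ i, x i * Real.log (x i)))
      * Real.exp (β / n * ((∑ k, (n * x k) ^ 2 - n) / 2) + h * (n * x 0))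
      = Real.exp (-β / 2) * Real.exp (-(n : ℝ) * freeEnergy q β h x) := by
    rw [← Real.exp_add, ← Real.exp_add, freeEnergy]
    congr 1
    simp_rw [mul_pow, ← Finset.mul_sum]
    field_simp
    ring
  have hratio := hM n hnM m hmM
  rw [sum_indicator_cwWeight_eq q n β h hm hsum, multinomial_eq_stirlingSeq hn0 hxpos hm hsum]
  generalize (Stirling.stirlingSeq n / √Real.pi) / (∏ i, Stirling.stirlingSeq (m i) / √Real.pi)
    = R at *
  convert hratio using 3
  rw [div_eq_iff (by unfold Apref; positivity), Apref]
  linear_combination R * (n : ℝ) ^ (-(((q : ℝ) - 1) / 2)) * ((2 * Real.pi) ^ (-(((q : ℝ) - 1) / 2))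
    * ∏ i, x i ^ (-(1 / 2 : ℝ))) * hexp
end

section
/- Let β, h ≥ 0 and let x ∈ Ω be a global minimizer of f_{β,h}. Define the quadratic form Q_{x,β}(w) = Σ_{i=1}^q (1/x_i − β) w_i² on the hyperplane H = {w ∈ ℝ^q : w_1+⋯+w_q = 0}. Then: (i) Q_{x,β} is positive definite on H if and only if (β,h) ≠ (β_0,h_0); (ii) if (β,h) = (β_0,h_0) (so that x = x_0 = (1/2, 1/(2(q−1)), …, 1/(2(q−1)))), the kernel of Q_{x,β} restricted to H is the line spanned by u = (1−q, 1, …, 1). -/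
open Real Filter Finset

/-- `β_0 = 4(q−1)/q`. -/
noncomputable def beta0 (q : ℕ) : ℝ := 4 * ((q : ℝ) - 1) / q

/-- `h_0 = log(q−1) − 2(q−2)/q`. -/
noncomputable def h0 (q : ℕ) : ℝ := Real.log ((q : ℝ) - 1) - 2 * ((q : ℝ) - 2) / q

/-- The quadratic form `Q_{x,β}(w) = ∑ (1/x_i − β) w_i²`. -/
noncomputable def Qform (q : ℕ) (β : ℝ) (x w : Fin q → ℝ) : ℝ :=
  ∑ i, (1 / x i - β) * w i ^ 2

/-- The point `x_0 = (1/2, 1/(2(q−1)), …, 1/(2(q−1)))`. -/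
noncomputable def xzero (q : ℕ) [NeZero q] : Fin q → ℝ :=
  fun i => if i = 0 then 1 / 2 else 1 / (2 * ((q : ℝ) - 1))

/-- The vector `u = (1−q, 1, …, 1)`. -/
noncomputable def uvec (q : ℕ) [NeZero q] : Fin q → ℝ :=
  fun i => if i = 0 then 1 - (q : ℝ) else 1

/-- A function vanishing at `0` whose derivative is negative to the right of `0` is itself
negative to the right of `0`. -/
lemma eventually_neg_of_hasDerivAt {F G : ℝ → ℝ} (h0 : F 0 = 0)
    (hc : ContinuousWithinAt F (Set.Ici 0) 0)
    (hd : ∀ᶠ s in nhdsWithin (0 : ℝ) (Set.Ioi 0), HasDerivAt F (G s) s)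
    (hG : ∀ᶠ s in nhdsWithin (0 : ℝ) (Set.Ioi 0), G s < 0) :
    ∀ᶠ s in nhdsWithin (0 : ℝ) (Set.Ioi 0), F s < 0 := by
  obtain ⟨δ, hδ, hδ'⟩ := mem_nhdsGT_iff_exists_Ioo_subset.1 (hd.and hG)
  have hδ0 : (0 : ℝ) < δ := hδ
  have hanti : StrictAntiOn F (Set.Ico 0 δ) := by
    apply strictAntiOn_of_deriv_neg (convex_Ico 0 δ)
    · intro s hs
      rcases eq_or_lt_of_le hs.1 with rfl | hs0
      · exact hc.mono (fun y hy => hy.1)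
      · exact (hδ' ⟨hs0, hs.2⟩).1.continuousAt.continuousWithinAt
    · intro s hs
      rw [interior_Ico] at hs
      rw [(hδ' hs).1.deriv]
      exact (hδ' hs).2
  filter_upwards [Ioo_mem_nhdsGT hδ0] with s hs
  rw [← h0]
  exact hanti ⟨le_rfl, hδ0⟩ ⟨hs.1.le, hs.2⟩ hs.1

/-- The derivative of the free energy along the line `s ↦ x + s w`. -/
noncomputable def freeEnergyDeriv (q : ℕ) [NeZero q] (β h : ℝ) (x w : Fin q → ℝ) (s : ℝ) : ℝ :=
  ∑ i, w i * (Real.log (x i + s * w i) + 1) - β * ∑ i, w i * (x i + s * w i) - h * w 0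

lemma hasDerivAt_freeEnergy_line {q : ℕ} [NeZero q] (β h : ℝ) (x w : Fin q → ℝ) {s : ℝ}
    (hs : ∀ i, w i = 0 ∨ x i + s * w i ≠ 0) :
    HasDerivAt (fun s => freeEnergy q β h (fun i => x i + s * w i))
      (freeEnergyDeriv q β h x w s) s := by
  have hl : ∀ i, HasDerivAt (fun s : ℝ => x i + s * w i) (w i) s := fun i => by
    simpa using ((hasDerivAt_id s).mul_const (w i)).const_add (x i)
  have h1 : ∀ i ∈ Finset.univ, HasDerivAt
      (fun s : ℝ => (x i + s * w i) * Real.log (x i + s * w i))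
      (w i * (Real.log (x i + s * w i) + 1)) s := fun i _ => by
    rcases hs i with h0 | h0
    · simpa [h0] using hasDerivAt_const s (x i * Real.log (x i))
    · refine ((hl i).mul ((hl i).log h0)).congr_deriv ?_
      generalize x i + s * w i = y at h0 ⊢
      field_simp
  have h2 : ∀ i ∈ Finset.univ, HasDerivAt (fun s : ℝ => (x i + s * w i) ^ 2)
      (2 * (w i * (x i + s * w i))) s := fun i _ => by
    refine ((hl i).pow 2).congr_deriv ?_
    simp; ring
  refine (((HasDerivAt.fun_sum h1).sub ((HasDerivAt.fun_sum h2).const_mul (β / 2))).sub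
    ((hl 0).const_mul h)).congr_deriv ?_
  rw [freeEnergyDeriv, ← Finset.mul_sum]
  ring

lemma continuous_freeEnergy_line {q : ℕ} [NeZero q] (β h : ℝ) (x w : Fin q → ℝ) :
    Continuous (fun s : ℝ => freeEnergy q β h (fun i => x i + s * w i)) := by
  unfold freeEnergy
  have : ∀ i, Continuous (fun s : ℝ => (x i + s * w i) * Real.log (x i + s * w i)) :=
    fun i => Real.continuous_mul_log.comp (by fun_prop)
  fun_prop

lemma eventually_line_pos {q : ℕ} {x : Fin q → ℝ} (hpos : ∀ i, 0 < x i) (w : Fin q → ℝ) :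
    ∀ᶠ s in nhds (0 : ℝ), ∀ i, 0 < x i + s * w i := by
  rw [eventually_all]
  intro i
  have : ContinuousAt (fun s : ℝ => x i + s * w i) 0 := by fun_prop
  exact this.eventually (lt_mem_nhds (by simpa using hpos i))

lemma hasDerivAt_Qform_line {q : ℕ} {β : ℝ} {x : Fin q → ℝ} (w : Fin q → ℝ) {s : ℝ}
    (hs : ∀ i, 0 < x i + s * w i) :
    HasDerivAt (fun s => Qform q β (fun i => x i + s * w i) w)
      (-∑ i, w i ^ 3 / (x i + s * w i) ^ 2) s := by
  have hl : ∀ i, HasDerivAt (fun s : ℝ => x i + s * w i) (w i) s := fun i => by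
    simpa using ((hasDerivAt_id s).mul_const (w i)).const_add (x i)
  have h1 : ∀ i ∈ Finset.univ, HasDerivAt
      (fun s : ℝ => (1 / (x i + s * w i) - β) * w i ^ 2)
      (-(w i ^ 3 / (x i + s * w i) ^ 2)) s := fun i _ => by
    simp only [one_div]
    refine ((((hl i).inv (hs i).ne').sub_const β).mul_const (w i ^ 2)).congr_deriv ?_
    ring
  rw [← Finset.sum_neg_distrib]
  exact HasDerivAt.fun_sum h1

section Minimizer

variable {q : ℕ} [NeZero q] {β h : ℝ} {x : Fin q → ℝ}

/-- Along a line that stays in the simplex to the right of a minimizer, the derivative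
of the free energy cannot be negative near the minimizer. -/
lemma not_eventually_freeEnergyDeriv_neg
    (hmin : ∀ y ∈ simplex q, freeEnergy q β h x ≤ freeEnergy q β h y) (w : Fin q → ℝ)
    (hs : ∀ᶠ s in nhdsWithin (0 : ℝ) (Set.Ioi 0), ∀ i, w i = 0 ∨ x i + s * w i ≠ 0)
    (hmem : ∀ᶠ s in nhdsWithin (0 : ℝ) (Set.Ioi 0), (fun i => x i + s * w i) ∈ simplex q) :
    ¬ ∀ᶠ s in nhdsWithin (0 : ℝ) (Set.Ioi 0), freeEnergyDeriv q β h x w s < 0 := by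
  intro hneg
  have := eventually_neg_of_hasDerivAt
    (F := fun s => freeEnergy q β h (fun i => x i + s * w i) - freeEnergy q β h x)
    (by simp) ((continuous_freeEnergy_line β h x w).sub continuous_const).continuousWithinAt
    (hs.mono fun s hs => (hasDerivAt_freeEnergy_line β h x w hs).sub_const _) hneg
  obtain ⟨s, hs1, hs2⟩ := (this.and hmem).exists
  linarith [hmin _ hs2]

lemma minimizer_pos (hx : x ∈ simplex q)
    (hmin : ∀ y ∈ simplex q, freeEnergy q β h x ≤ freeEnergy q β h y) (j : Fin q) :
    0 < x j := by
  by_contra hj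
  have hj0 : x j = 0 := le_antisymm (not_lt.1 hj) (hx.1 j)
  obtain ⟨k, hk⟩ : ∃ k, 0 < x k := by
    by_contra! hcon
    have := Finset.sum_nonpos (fun i (_ : i ∈ Finset.univ) => hcon i)
    linarith [hx.2]
  have hkj : k ≠ j := fun e => hj (e ▸ hk)
  set w : Fin q → ℝ := Pi.single j 1 - Pi.single k 1 with hw
  have wj : w j = 1 := by simp [hw, hkj.symm]
  have wk : w k = -1 := by simp [hw, hkj]
  have wi : ∀ i, i ≠ j → i ≠ k → w i = 0 := fun i h1 h2 => by simp [hw, h1, h2]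
  have wsum : ∀ c : Fin q → ℝ, ∑ i, w i * c i = c j - c k := fun c => by
    simp [hw, sub_mul, Finset.sum_sub_distrib, Pi.single_apply]
  have hsm : ∀ᶠ s in nhdsWithin (0 : ℝ) (Set.Ioi 0), s ∈ Set.Ioo 0 (x k) :=
    Ioo_mem_nhdsGT hk
  refine not_eventually_freeEnergyDeriv_neg hmin w ?_ ?_ ?_
  · filter_upwards [hsm] with s hs i
    by_cases h1 : i = j
    · subst h1; right; rw [wj, hj0]; linarith [hs.1]
    by_cases h2 : i = k
    · subst h2; right; rw [wk]; linarith [hs.2]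
    exact Or.inl (wi i h1 h2)
  · filter_upwards [hsm] with s hs
    refine ⟨fun i => ?_, ?_⟩
    · by_cases h1 : i = j
      · subst h1; simp only [wj, hj0]; linarith [hs.1]
      by_cases h2 : i = k
      · subst h2; simp only [wk]; linarith [hs.2]
      simpa [wi i h1 h2] using hx.1 i
    · have := wsum 1
      simp only [Pi.one_apply, mul_one, sub_self] at this
      rw [Finset.sum_add_distrib, ← Finset.mul_sum, this, hx.2]; simp
  · have heq : freeEnergyDeriv q β h x w = fun s => Real.log s +
        (1 - (Real.log (x k + s * -1) + 1) - β * (s - (x k + s * -1)) - h * w 0) := by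
      funext s
      rw [freeEnergyDeriv, wsum, wsum, wj, wk, hj0]
      ring_nf
    have hrest : ContinuousAt (fun s : ℝ =>
        1 - (Real.log (x k + s * -1) + 1) - β * (s - (x k + s * -1)) - h * w 0) 0 := by
      have : ContinuousAt (fun s : ℝ => Real.log (x k + s * -1)) 0 :=
        ContinuousAt.log (by fun_prop) (by simpa using hk.ne')
      fun_prop
    rw [heq]
    exact (Real.tendsto_log_nhdsGT_zero.atBot_add
      (hrest.tendsto.mono_left nhdsWithin_le_nhds)).eventually_lt_atBot 0

lemma not_eventually_freeEnergyDeriv_neg_of_pos (hx : x ∈ simplex q) (hpos : ∀ i, 0 < x i)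
    (hmin : ∀ y ∈ simplex q, freeEnergy q β h x ≤ freeEnergy q β h y) {w : Fin q → ℝ}
    (hw : ∑ i, w i = 0) :
    ¬ ∀ᶠ s in nhdsWithin (0 : ℝ) (Set.Ioi 0), freeEnergyDeriv q β h x w s < 0 := by
  have hev := (eventually_line_pos hpos w).filter_mono
    (nhdsWithin_le_nhds (s := Set.Ioi (0 : ℝ)))
  refine not_eventually_freeEnergyDeriv_neg hmin w (hev.mono fun s hs i => Or.inr (hs i).ne')
    (hev.mono fun s hs => ⟨fun i => (hs i).le, ?_⟩)
  rw [Finset.sum_add_distrib, ← Finset.mul_sum, hw, hx.2]; simp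

/-- The second derivative of the free energy along the line `s ↦ x + s w` is a value of
`Qform`. -/
lemma hasDerivAt_freeEnergyDeriv (w : Fin q → ℝ) {s : ℝ} (hs : ∀ i, 0 < x i + s * w i) :
    HasDerivAt (freeEnergyDeriv q β h x w) (Qform q β (fun i => x i + s * w i) w) s := by
  have hl : ∀ i, HasDerivAt (fun s : ℝ => x i + s * w i) (w i) s := fun i => by
    simpa using ((hasDerivAt_id s).mul_const (w i)).const_add (x i)
  have h1 : ∀ i ∈ Finset.univ, HasDerivAt
      (fun s : ℝ => w i * (Real.log (x i + s * w i) + 1))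
      (w i * (w i / (x i + s * w i))) s := fun i _ =>
    (((hl i).log (hs i).ne').add_const 1).const_mul (w i)
  have h2 : ∀ i ∈ Finset.univ, HasDerivAt (fun s : ℝ => w i * (x i + s * w i))
      (w i * w i) s := fun i _ => (hl i).const_mul (w i)
  refine (((HasDerivAt.fun_sum h1).sub ((HasDerivAt.fun_sum h2).const_mul β)).sub_const
    (h * w 0)).congr_deriv ?_
  rw [Qform, Finset.mul_sum, ← Finset.sum_sub_distrib]
  refine Finset.sum_congr rfl fun i _ => ?_
  ring

lemma freeEnergyDeriv_eq_zero (hx : x ∈ simplex q) (hpos : ∀ i, 0 < x i)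
    (hmin : ∀ y ∈ simplex q, freeEnergy q β h x ≤ freeEnergy q β h y) {w : Fin q → ℝ}
    (hw : ∑ i, w i = 0) : freeEnergyDeriv q β h x w 0 = 0 := by
  have key : ∀ w : Fin q → ℝ, ∑ i, w i = 0 → 0 ≤ freeEnergyDeriv q β h x w 0 := fun w hw => by
    by_contra! hneg
    refine not_eventually_freeEnergyDeriv_neg_of_pos hx hpos hmin hw ?_
    exact ((hasDerivAt_freeEnergyDeriv w (eventually_line_pos hpos w).self_of_nhds).continuousAt
      |>.eventually (gt_mem_nhds hneg)).filter_mono nhdsWithin_le_nhds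
  have h1 := key w hw
  have h2 := key (fun i => -w i) (by simp [hw])
  simp only [freeEnergyDeriv, zero_mul, add_zero, neg_mul, Finset.sum_neg_distrib] at h1 h2 ⊢
  linarith

lemma Qform_nonneg (hx : x ∈ simplex q) (hpos : ∀ i, 0 < x i)
    (hmin : ∀ y ∈ simplex q, freeEnergy q β h x ≤ freeEnergy q β h y) {w : Fin q → ℝ}
    (hw : ∑ i, w i = 0) : 0 ≤ Qform q β x w := by
  by_contra! hneg
  refine not_eventually_freeEnergyDeriv_neg_of_pos hx hpos hmin hw ?_
  have hev := eventually_line_pos hpos w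
  refine eventually_neg_of_hasDerivAt (freeEnergyDeriv_eq_zero hx hpos hmin hw)
    (hasDerivAt_freeEnergyDeriv w hev.self_of_nhds).continuousAt.continuousWithinAt
    ((hev.mono fun s hs => hasDerivAt_freeEnergyDeriv w hs).filter_mono nhdsWithin_le_nhds) ?_
  exact ((hasDerivAt_Qform_line w hev.self_of_nhds).continuousAt.eventually
    (gt_mem_nhds (by simpa using hneg))).filter_mono nhdsWithin_le_nhds

/-- In a null direction of the Hessian the third derivative vanishes as well. -/
lemma sum_cube_div_sq_eq_zero (hx : x ∈ simplex q) (hpos : ∀ i, 0 < x i)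
    (hmin : ∀ y ∈ simplex q, freeEnergy q β h x ≤ freeEnergy q β h y) {w : Fin q → ℝ}
    (hw : ∑ i, w i = 0) (hQ : Qform q β x w = 0) : ∑ i, w i ^ 3 / x i ^ 2 = 0 := by
  have key : ∀ w : Fin q → ℝ, ∑ i, w i = 0 → Qform q β x w = 0 →
      ∑ i, w i ^ 3 / x i ^ 2 ≤ 0 := fun w hw hQ => by
    by_contra! hneg
    refine not_eventually_freeEnergyDeriv_neg_of_pos hx hpos hmin hw ?_
    have hev := eventually_line_pos hpos w
    refine eventually_neg_of_hasDerivAt (freeEnergyDeriv_eq_zero hx hpos hmin hw)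
      (hasDerivAt_freeEnergyDeriv w hev.self_of_nhds).continuousAt.continuousWithinAt
      ((hev.mono fun s hs => hasDerivAt_freeEnergyDeriv w hs).filter_mono nhdsWithin_le_nhds) ?_
    refine eventually_neg_of_hasDerivAt (by simpa using hQ)
      (hasDerivAt_Qform_line w hev.self_of_nhds).continuousAt.continuousWithinAt
      ((hev.mono fun s hs => hasDerivAt_Qform_line w hs).filter_mono nhdsWithin_le_nhds) ?_
    have hc : ContinuousAt (fun s : ℝ => -∑ i, w i ^ 3 / (x i + s * w i) ^ 2) 0 := by
      have : ∀ i, ContinuousAt (fun s : ℝ => w i ^ 3 / (x i + s * w i) ^ 2) 0 := fun i =>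
        ContinuousAt.div (by fun_prop) (by fun_prop) (by simpa using (hpos i).ne')
      fun_prop
    exact (hc.eventually (gt_mem_nhds (by simpa using hneg))).filter_mono nhdsWithin_le_nhds
  refine le_antisymm (key w hw hQ) ?_
  have := key (fun i => -w i) (by simp [hw]) (by simpa [Qform] using hQ)
  simpa [Odd.neg_pow (show Odd 3 by decide), neg_div] using this

end Minimizer

lemma sum_eq_add_mul_of_ne {q : ℕ} {g : Fin q → ℝ} {m : Fin q} {B : ℝ}
    (hg : ∀ i, i ≠ m → g i = B) : ∑ i, g i = g m + ((q : ℝ) - 1) * B := by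
  have hq : 1 ≤ q := Nat.one_le_of_lt m.2
  rw [← Finset.add_sum_erase Finset.univ g (Finset.mem_univ m),
    Finset.sum_congr rfl fun i hi => hg i (Finset.ne_of_mem_erase hi), Finset.sum_const,
    Finset.card_erase_of_mem (Finset.mem_univ m), Finset.card_univ, Fintype.card_fin,
    nsmul_eq_mul, Nat.cast_sub hq, Nat.cast_one]

/-- Diagonalization of `Qform` on the hyperplane at a point all of whose coordinates but
one agree. -/
lemma Qform_eq_of_forall_ne {q : ℕ} (hq : 2 ≤ q) (β : ℝ) {x w : Fin q → ℝ} {m : Fin q} {a : ℝ}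
    (hxa : ∀ i, i ≠ m → x i = a) (hw : ∑ i, w i = 0) :
    Qform q β x w = ((1 / x m - β) + (1 / a - β) / ((q : ℝ) - 1)) * w m ^ 2 +
      (1 / a - β) * ∑ i ∈ Finset.univ.erase m, (w i + w m / ((q : ℝ) - 1)) ^ 2 := by
  have hn : (0 : ℝ) < (q : ℝ) - 1 := by
    have : (2 : ℝ) ≤ q := by exact_mod_cast hq
    linarith
  have hcard : (((Finset.univ.erase m).card : ℕ) : ℝ) = (q : ℝ) - 1 := by
    rw [Finset.card_erase_of_mem (Finset.mem_univ m), Finset.card_univ, Fintype.card_fin,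
      Nat.cast_sub (by lia), Nat.cast_one]
  have hw' : ∑ i ∈ Finset.univ.erase m, w i = -w m := by
    linarith [Finset.add_sum_erase Finset.univ w (Finset.mem_univ m)]
  have hsq : ∑ i ∈ Finset.univ.erase m, (w i + w m / ((q : ℝ) - 1)) ^ 2 =
      ∑ i ∈ Finset.univ.erase m, w i ^ 2 - w m ^ 2 / ((q : ℝ) - 1) := by
    simp only [add_sq, Finset.sum_add_distrib, ← Finset.sum_mul, ← Finset.mul_sum, hw',
      Finset.sum_const, nsmul_eq_mul, hcard]
    field_simp
    ring
  rw [hsq, Qform, ← Finset.add_sum_erase _ _ (Finset.mem_univ m),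
    Finset.sum_congr rfl fun i hi => by rw [hxa i (Finset.ne_of_mem_erase hi)],
    ← Finset.mul_sum]
  ring

lemma two_mul_sub_div_add_lt_log_sub_log {u v : ℝ} (hu : 0 < u) (huv : u < v) :
    2 * (v - u) / (v + u) < Real.log v - Real.log u := by
  have hv : 0 < v := hu.trans huv
  have := Real.lt_log_one_add_of_pos (x := v / u - 1) (by rw [sub_pos, one_lt_div hu]; exact huv)
  rw [add_sub_cancel, Real.log_div hv.ne' hu.ne'] at this
  convert this using 1
  have : v + u ≠ 0 := by positivity
  rw [show v / u - 1 + 2 = (v + u) / u by field_simp; ring]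
  field_simp

lemma eq_half_of_log_sub_log_eq {b : ℝ} (h0 : 0 < b) (h1 : b < 1)
    (h : Real.log b - Real.log (1 - b) = 4 * b - 2) : b = 1 / 2 := by
  rcases lt_trichotomy b (1 / 2) with hb | hb | hb
  · have := two_mul_sub_div_add_lt_log_sub_log h0 (show b < 1 - b by linarith)
    rw [show 1 - b + b = 1 by ring, div_one] at this
    linarith
  · exact hb
  · have := two_mul_sub_div_add_lt_log_sub_log (sub_pos.2 h1) (show 1 - b < b by linarith)
    rw [show b + (1 - b) = 1 by ring, div_one] at this
    linarith

lemma freeEnergy_comp_perm {q : ℕ} [NeZero q] (β h : ℝ) (x : Fin q → ℝ)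
    (σ : Equiv.Perm (Fin q)) :
    freeEnergy q β h (x ∘ σ) = freeEnergy q β h x - h * (x (σ 0) - x 0) := by
  have h1 := Equiv.sum_comp σ fun i => x i * Real.log (x i)
  have h2 := Equiv.sum_comp σ fun i => x i ^ 2
  simp only [freeEnergy, Function.comp_apply, h1, h2]
  ring

lemma le_apply_zero_of_minimizer {q : ℕ} [NeZero q] {β h : ℝ} {x : Fin q → ℝ} (hh : 0 < h)
    (hx : x ∈ simplex q)
    (hmin : ∀ y ∈ simplex q, freeEnergy q β h x ≤ freeEnergy q β h y) (k : Fin q) :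
    x k ≤ x 0 := by
  have := hmin (x ∘ Equiv.swap 0 k)
    ⟨fun i => hx.1 _, (Equiv.sum_comp (Equiv.swap 0 k) x).trans hx.2⟩
  rw [freeEnergy_comp_perm, Equiv.swap_apply_left] at this
  nlinarith

/-- All coordinates of a minimizer other than a largest one agree, and the largest one may be
taken to be the coordinate `0` when the field is nonzero. -/
lemma exists_eq_of_ne_of_minimizer {q : ℕ} [NeZero q] (hq : 2 ≤ q) {β h : ℝ} (hh : 0 ≤ h)
    {x : Fin q → ℝ} (hx : x ∈ simplex q)
    (hmin : ∀ y ∈ simplex q, freeEnergy q β h x ≤ freeEnergy q β h y) :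
    ∃ (m : Fin q) (a : ℝ), (m = 0 ∨ h = 0) ∧ 0 < a ∧ a ≤ x m ∧ ∀ i, i ≠ m → x i = a := by
  have hpos := minimizer_pos hx hmin
  obtain ⟨m, hm, hmax⟩ : ∃ m : Fin q, (m = 0 ∨ h = 0) ∧ ∀ k, x k ≤ x m := by
    rcases hh.eq_or_lt with h0 | h0
    · obtain ⟨m, hm⟩ := Finite.exists_max x
      exact ⟨m, Or.inr h0.symm, hm⟩
    · exact ⟨0, Or.inl rfl, le_apply_zero_of_minimizer h0 hx hmin⟩
  have key : ∀ i j, i ≠ m → j ≠ m → ¬ x i < x j := by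
    intro i j hi hj hlt
    have hij : i ≠ j := fun e => hlt.ne (by rw [e])
    have hsum : ∀ k l : Fin q, ∀ c : Fin q → ℝ,
        ∑ r, (Pi.single k 1 - Pi.single l 1 : Fin q → ℝ) r * c r = c k - c l := fun k l c => by
      simp [sub_mul, Finset.sum_sub_distrib, Pi.single_apply]
    have hsum0 : ∀ k l : Fin q, ∑ r, (Pi.single k 1 - Pi.single l 1 : Fin q → ℝ) r = 0 :=
      fun k l => by simp
    have h1 := freeEnergyDeriv_eq_zero hx hpos hmin (hsum0 j i)
    have hfield : h * (Pi.single j 1 - Pi.single i 1 : Fin q → ℝ) 0 = 0 := by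
      rcases hm with rfl | h0
      · simp [hi.symm, hj.symm]
      · simp [h0]
    rw [freeEnergyDeriv, hfield, hsum, hsum] at h1
    simp only [zero_mul, add_zero] at h1
    have hlog := Real.log_lt_sub_one_of_pos (div_pos (hpos i) (hpos j))
      (by rw [Ne, div_eq_one_iff_eq (hpos j).ne']; exact hlt.ne)
    rw [Real.log_div (hpos i).ne' (hpos j).ne'] at hlog
    have hβj : 1 / x j < β := by
      have : (1 / x j) * (x j - x i) = 1 - x i / x j := by
        have := (hpos j).ne'
        field_simp
      by_contra! hcon
      nlinarith [mul_le_mul_of_nonneg_right hcon (sub_pos.2 hlt).le]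
    have hβm : 1 / x m ≤ 1 / x j := one_div_le_one_div_of_le (hpos j) (hmax j)
    have h2 := Qform_nonneg hx hpos hmin (hsum0 m j)
    have h3 : Qform q β x (Pi.single m 1 - Pi.single j 1) = (1 / x m - β) + (1 / x j - β) := by
      have := hsum m j fun r =>
        (1 / x r - β) * (Pi.single m 1 - Pi.single j 1 : Fin q → ℝ) r
      rw [Qform]
      calc _ = _ := Finset.sum_congr rfl fun r _ => by ring
        _ = _ := this
        _ = _ := by simp [hj, hj.symm]; ring
    linarith
  have : Nontrivial (Fin q) := Fin.nontrivial_iff_two_le.2 hq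
  obtain ⟨i, hi⟩ := exists_ne m
  exact ⟨m, x i, hm, hpos i, hmax i, fun j hj =>
    le_antisymm (not_lt.1 (key i j hi hj)) (not_lt.1 (key j i hj hi))⟩

lemma Qform_xzero_eq_zero_iff {q : ℕ} [NeZero q] (hq : 2 ≤ q) {w : Fin q → ℝ}
    (hw : ∑ i, w i = 0) :
    Qform q (beta0 q) (xzero q) w = 0 ↔ ∃ c : ℝ, w = c • uvec q := by
  have hq' : (2 : ℝ) ≤ q := by exact_mod_cast hq
  have hn : (0 : ℝ) < (q : ℝ) - 1 := by linarith
  have hQ := Qform_eq_of_forall_ne hq (beta0 q) (x := xzero q) (m := 0)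
    (a := 1 / (2 * ((q : ℝ) - 1))) (fun i hi => by simp [xzero, hi]) hw
  have hcoef : (1 / xzero q 0 - beta0 q) +
      (1 / (1 / (2 * ((q : ℝ) - 1))) - beta0 q) / ((q : ℝ) - 1) = 0 := by
    simp only [xzero, beta0, if_true]
    field_simp
    ring
  have hcoef' : 1 / (1 / (2 * ((q : ℝ) - 1))) - beta0 q =
      2 * ((q : ℝ) - 1) * ((q : ℝ) - 2) / q := by
    simp only [beta0]
    field_simp
    ring
  rw [hcoef, hcoef', zero_mul, zero_add] at hQ
  rw [hQ]
  constructor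
  · intro hzero
    rcases hq.eq_or_lt with rfl | hlt
    · rw [Fin.sum_univ_two] at hw
      refine ⟨w 1, funext fun i => ?_⟩
      fin_cases i
      · simp [uvec]; linarith
      · simp [uvec]
    · have hlt' : (2 : ℝ) < q := by exact_mod_cast hlt
      have hc : 2 * ((q : ℝ) - 1) * ((q : ℝ) - 2) / q ≠ 0 :=
        (div_pos (mul_pos (by linarith) (by linarith)) (by linarith)).ne'
      have hs := (Finset.sum_eq_zero_iff_of_nonneg fun i _ => sq_nonneg _).1
        ((mul_eq_zero.1 hzero).resolve_left hc)
      refine ⟨-(w 0 / ((q : ℝ) - 1)), funext fun i => ?_⟩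
      by_cases hi : i = 0
      · subst hi
        simp only [uvec, Pi.smul_apply, smul_eq_mul, if_true]
        field_simp
        ring
      · have := pow_eq_zero_iff two_ne_zero |>.1 (hs i (by simp [hi]))
        simp only [uvec, Pi.smul_apply, smul_eq_mul, hi, if_false]
        linarith
  · rintro ⟨c, rfl⟩
    refine mul_eq_zero_of_right _ (Finset.sum_eq_zero fun i hi => ?_)
    simp only [uvec, Pi.smul_apply, smul_eq_mul, Finset.ne_of_mem_erase hi, if_false, if_true]
    field_simp
    ring

/-- A minimizer whose Hessian degenerates along the line of points with equal minor coordinates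
occurs exactly at the parameters `(β_0, h_0)`. -/
lemma radial_coeff_eq_zero_iff {q : ℕ} [NeZero q] (hq : 2 ≤ q) {β h : ℝ} {x : Fin q → ℝ}
    (hx : x ∈ simplex q)
    (hmin : ∀ y ∈ simplex q, freeEnergy q β h x ≤ freeEnergy q β h y) {m : Fin q} {a : ℝ}
    (hm : m = 0 ∨ h = 0) (ha : 0 < a) (hxa : ∀ i, i ≠ m → x i = a) :
    (1 / x m - β) + (1 / a - β) / ((q : ℝ) - 1) = 0 ↔ (β, h) = (beta0 q, h0 q) := by
  have hpos := minimizer_pos hx hmin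
  have hq' : (2 : ℝ) ≤ q := by exact_mod_cast hq
  have hn : (0 : ℝ) < (q : ℝ) - 1 := by linarith
  have hb := hpos m
  have hsum : x m + ((q : ℝ) - 1) * a = 1 := by rw [← sum_eq_add_mul_of_ne hxa, hx.2]
  set w : Fin q → ℝ := fun i => if i = m then -((q : ℝ) - 1) else 1 with hwdef
  have wm : w m = -((q : ℝ) - 1) := by simp [hwdef]
  have wi : ∀ i, i ≠ m → w i = 1 := fun i hi => by simp [hwdef, hi]
  have hw : ∑ i, w i = 0 := by rw [sum_eq_add_mul_of_ne wi, wm]; ring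
  have hfirst : Real.log (x m) - Real.log a - β * (x m - a) - h = 0 := by
    have h1 := freeEnergyDeriv_eq_zero hx hpos hmin hw
    have hfield : h * w 0 = -((q : ℝ) - 1) * h := by
      rcases hm with rfl | h0
      · rw [wm]; ring
      · simp [h0]
    rw [freeEnergyDeriv, hfield,
      sum_eq_add_mul_of_ne (m := m) (B := Real.log a + 1) (fun i hi => by simp [wi i hi, hxa i hi]),
      sum_eq_add_mul_of_ne (m := m) (B := a) (fun i hi => by simp [wi i hi, hxa i hi]), wm] at h1
    simp only [zero_mul, add_zero] at h1
    refine (mul_eq_zero.1 (?_ : ((q : ℝ) - 1) * _ = 0)).resolve_left hn.ne'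
    linear_combination -h1
  constructor
  · intro hD
    have hQ : Qform q β x w = 0 := by
      rw [Qform_eq_of_forall_ne hq β hxa hw, hD, zero_mul, zero_add]
      refine mul_eq_zero_of_right _ (Finset.sum_eq_zero fun i hi => ?_)
      rw [wi i (Finset.ne_of_mem_erase hi), wm, neg_div, div_self hn.ne']
      norm_num
    have h3 := sum_cube_div_sq_eq_zero hx hpos hmin hw hQ
    rw [sum_eq_add_mul_of_ne (m := m) (B := 1 / a ^ 2)
      (fun i hi => by simp [wi i hi, hxa i hi]), wm] at h3
    have hsq : x m ^ 2 = (((q : ℝ) - 1) * a) ^ 2 := by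
      field_simp at h3
      rw [mul_zero] at h3
      linarith [(mul_eq_zero.1 h3).resolve_left hn.ne']
    have hba : x m = ((q : ℝ) - 1) * a :=
      (pow_left_inj₀ hb.le (by positivity) two_ne_zero).1 hsq
    have hbhalf : x m = 1 / 2 := by linarith
    have hahalf : a = 1 / (2 * ((q : ℝ) - 1)) := by
      field_simp
      linarith
    have hβ : β = beta0 q := by
      rw [hbhalf, hahalf] at hD
      rw [beta0]
      field_simp at hD ⊢
      linarith
    have hh : h = h0 q := by
      rw [hbhalf, hahalf, Real.log_div one_ne_zero two_ne_zero,
        Real.log_div one_ne_zero (by positivity), Real.log_mul two_ne_zero hn.ne', hβ,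
        beta0] at hfirst
      rw [h0]
      have : 4 * ((q : ℝ) - 1) / q * (1 / 2 - 1 / (2 * ((q : ℝ) - 1))) =
          2 * ((q : ℝ) - 2) / q := by
        field_simp
        ring
      linarith
    rw [hβ, hh]
  · intro heq
    obtain ⟨rfl, rfl⟩ := Prod.mk.inj heq
    have ha' : a = (1 - x m) / ((q : ℝ) - 1) := by
      field_simp
      linarith
    have hb1 : x m < 1 := by nlinarith
    rw [ha', Real.log_div (by linarith) hn.ne', h0, beta0] at hfirst
    have hlin : 4 * ((q : ℝ) - 1) / q * (x m - (1 - x m) / ((q : ℝ) - 1)) -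
        2 * ((q : ℝ) - 2) / q = 4 * x m - 2 := by
      field_simp
      ring
    have hbhalf := eq_half_of_log_sub_log_eq hb hb1 (by linarith)
    rw [ha', hbhalf, beta0]
    field_simp
    ring

/-- for a global minimizer `x` of `f_{β,h}`, the quadratic form
`Q_{x,β}` is positive definite on the hyperplane `H = {∑ w_i = 0}` iff
`(β,h) ≠ (β_0,h_0)`; and at `(β_0,h_0)` with `x = x_0` its kernel in `H` is the
line spanned by `u = (1−q,1,…,1)`. -/
theorem stmt_11 (q : ℕ) [NeZero q] (hq : 2 ≤ q) (β h : ℝ) (hβ : 0 ≤ β) (hh : 0 ≤ h)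
    (x : Fin q → ℝ) (hx : x ∈ simplex q)
    (hmin : ∀ y ∈ simplex q, freeEnergy q β h x ≤ freeEnergy q β h y) :
    ((∀ w : Fin q → ℝ, ∑ i, w i = 0 → w ≠ 0 → 0 < Qform q β x w)
        ↔ (β, h) ≠ (beta0 q, h0 q)) ∧
    ((β, h) = (beta0 q, h0 q) → x = xzero q →
      ∀ w : Fin q → ℝ, ∑ i, w i = 0 →
        (Qform q β x w = 0 ↔ ∃ c : ℝ, w = c • uvec q)) := by
  refine ⟨?_, ?_⟩
  · obtain ⟨m, a, hm, ha, hax, hxa⟩ := exists_eq_of_ne_of_minimizer hq hh hx hmin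
    have hq' : (2 : ℝ) ≤ q := by exact_mod_cast hq
    have hn : (0 : ℝ) < (q : ℝ) - 1 := by linarith
    have hpos := minimizer_pos hx hmin
    set w₀ : Fin q → ℝ := fun i => if i = m then -((q : ℝ) - 1) else 1 with hw₀
    have wm : w₀ m = -((q : ℝ) - 1) := by simp [hw₀]
    have wi : ∀ i, i ≠ m → w₀ i = 1 := fun i hi => by simp [hw₀, hi]
    have hw₀sum : ∑ i, w₀ i = 0 := by rw [sum_eq_add_mul_of_ne wi, wm]; ring
    have hQ₀ : Qform q β x w₀ =
        ((1 / x m - β) + (1 / a - β) / ((q : ℝ) - 1)) * ((q : ℝ) - 1) ^ 2 := by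
      rw [Qform_eq_of_forall_ne hq β hxa hw₀sum, Finset.sum_eq_zero fun i hi => by
        rw [wi i (Finset.ne_of_mem_erase hi), wm, neg_div, div_self hn.ne']; norm_num, wm]
      ring
    rw [Ne, ← radial_coeff_eq_zero_iff hq hx hmin hm ha hxa]
    constructor
    · intro hall hD
      have := hall w₀ hw₀sum fun e => by
        have := congrFun e m
        rw [wm, Pi.zero_apply] at this
        linarith
      rw [hQ₀, hD, zero_mul] at this
      exact lt_irrefl _ this
    · intro hD w hw hw0
      have hDpos : 0 < (1 / x m - β) + (1 / a - β) / ((q : ℝ) - 1) := by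
        refine lt_of_le_of_ne ?_ (Ne.symm hD)
        have := Qform_nonneg hx hpos hmin hw₀sum
        rw [hQ₀] at this
        exact nonneg_of_mul_nonneg_left this (by positivity)
      have hapos : 0 < 1 / a - β := by
        have h1 : 1 / x m ≤ 1 / a := one_div_le_one_div_of_le ha hax
        by_contra! hcon
        have := div_nonpos_of_nonpos_of_nonneg hcon hn.le
        linarith
      rw [Qform_eq_of_forall_ne hq β hxa hw]
      by_cases hwm : w m = 0
      · obtain ⟨i, hi⟩ := Function.ne_iff.1 hw0
        have him : i ≠ m := fun e => hi (by rw [e, hwm]; rfl)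
        simp only [hwm, zero_div, add_zero]
        have : 0 < ∑ i ∈ Finset.univ.erase m, w i ^ 2 :=
          Finset.sum_pos' (fun i _ => sq_nonneg _) ⟨i, by simp [him], sq_pos_of_ne_zero hi⟩
        positivity
      · have : 0 ≤ ∑ i ∈ Finset.univ.erase m, (w i + w m / ((q : ℝ) - 1)) ^ 2 :=
          Finset.sum_nonneg fun i _ => sq_nonneg _
        positivity
  · rintro heq rfl w hw
    rw [(Prod.mk.inj heq).1]
    exact Qform_xzero_eq_zero_iff hq hw
end

section
/- Assume (β_n,h_n) → (β,h) with β, h ≥ 0, let x ∈ Ω be a global minimizer of f_{β,h}, and for each n let d_n be an element of minimal Euclidean norm among d ∈ H such that x + d ∈ Ω is a local minimizer of f_{β_n,h_n} on Ω. Then: (i) for every R > 0, n f_{β_n,h_n}(x + d_n + n^{−1/2} w) = n f_{β_n,h_n}(x + d_n) + (1/2) Q_{x,β}(w) + o_n(1) uniformly over w ∈ H with ‖w‖ ≤ R, where Q_{x,β}(w) = Σ_{i=1}^q (1/x_i − β) w_i²; (ii) if (β,h) ≠ (β_0,h_0), then for all sufficiently small ε > 0 there exists λ > 0 such that, for all sufficiently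 large n and all w ∈ H with ‖w‖ ≤ ε n^{1/2}, n f_{β_n,h_n}(x + d_n + n^{−1/2} w) ≥ n f_{β_n,h_n}(x + d_n) + λ ‖w‖². -/
open Real Filter Finset Topology MeasureTheory

/-- Fourth order Taylor bound for `x log x`. -/
lemma abs_mul_log_taylor_le {a u : ℝ} (ha : 0 < a) (hu : |u| ≤ a / 2) :
    |(a + u) * Real.log (a + u) - (a * Real.log a + (Real.log a + 1) * u + u ^ 2 / (2 * a)
      - u ^ 3 / (6 * a ^ 2))| ≤ 4 / a ^ 3 * u ^ 4 := by
  obtain ⟨z, rfl⟩ : ∃ z, u = a * z := ⟨u / a, by field_simp⟩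
  have hz : |z| ≤ 1 / 2 := by
    rw [abs_mul, abs_of_pos ha] at hu
    nlinarith
  have hz' := abs_le.1 hz
  have hlog : Real.log (a + a * z) = Real.log a + Real.log (1 + z) := by
    rw [← Real.log_mul ha.ne' (by linarith), mul_add, mul_one]
  have h4 := Real.abs_log_sub_add_sum_range_le (x := -z) (by rw [abs_neg]; linarith) 3
  have h5 : |-z| ^ (3 + 1) / (1 - |-z|) ≤ 2 * z ^ 4 := by
    rw [abs_neg, div_le_iff₀ (by linarith)]
    have : |z| ^ (3 + 1) = z ^ 4 := by
      rw [show 3 + 1 = 2 * 2 from rfl, pow_mul, sq_abs, ← pow_mul]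
    rw [this]
    nlinarith [show 0 ≤ z ^ 4 by positivity]
  have h6 := h4.trans h5
  simp only [Finset.sum_range_succ, Finset.sum_range_zero] at h6
  norm_num at h6
  set r := -z + z ^ 2 / 2 + (-z) ^ 3 / 3 + Real.log (1 + z) with hr
  have key : (a + a * z) * Real.log (a + a * z) - (a * Real.log a + (Real.log a + 1) * (a * z)
      + (a * z) ^ 2 / (2 * a) - (a * z) ^ 3 / (6 * a ^ 2)) = a * (z ^ 4 / 3 + (1 + z) * r) := by
    rw [hlog, hr]; field_simp; ring
  rw [key, abs_mul, abs_of_pos ha, show 4 / a ^ 3 * (a * z) ^ 4 = a * (4 * z ^ 4) by field_simp]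
  refine mul_le_mul_of_nonneg_left ?_ ha.le
  have h7 : |(1 + z) * r| ≤ 3 / 2 * (2 * z ^ 4) := by
    rw [abs_mul]
    refine mul_le_mul ?_ h6 (abs_nonneg _) (by norm_num)
    rw [abs_le]; constructor <;> linarith
  have h8 := abs_add_le (z ^ 4 / 3) ((1 + z) * r)
  rw [abs_of_nonneg (show 0 ≤ z ^ 4 / 3 by positivity)] at h8
  nlinarith [show 0 ≤ z ^ 4 by positivity]

/-- The `i`-th partial derivative of the free energy. -/
noncomputable def freeEnergyGrad (q : ℕ) [NeZero q] (β h : ℝ) (y : Fin q → ℝ) (i : Fin q) : ℝ :=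
  Real.log (y i) + 1 - β * y i - if i = 0 then h else 0

lemma abs_freeEnergy_taylor_four_le {q : ℕ} [NeZero q] (β h : ℝ) {c : ℝ} (hc : 0 < c)
    {y u : Fin q → ℝ} (hy : ∀ i, c ≤ y i) (hu : ∀ i, |u i| ≤ c / 2) :
    |freeEnergy q β h (y + u) - (freeEnergy q β h y + ∑ i, freeEnergyGrad q β h y i * u i
      + 1 / 2 * Qform q β y u - ∑ i, u i ^ 3 / (6 * y i ^ 2))| ≤ 4 / c ^ 3 * ∑ i, u i ^ 4 := by
  have key : freeEnergy q β h (y + u) - (freeEnergy q β h y + ∑ i, freeEnergyGrad q β h y i * u i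
      + 1 / 2 * Qform q β y u - ∑ i, u i ^ 3 / (6 * y i ^ 2)) =
      ∑ i, ((y i + u i) * Real.log (y i + u i) - (y i * Real.log (y i)
        + (Real.log (y i) + 1) * u i + u i ^ 2 / (2 * y i) - u i ^ 3 / (6 * y i ^ 2))) := by
    have h0 : ∀ v : Fin q → ℝ, h * v 0 = ∑ i, (if i = 0 then h else 0) * v i := by
      intro v; simp
    simp only [freeEnergy, Qform, freeEnergyGrad]
    rw [h0, h0]
    simp only [Finset.mul_sum, ← Finset.sum_sub_distrib, ← Finset.sum_add_distrib, Pi.add_apply]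
    refine Finset.sum_congr rfl fun i _ => ?_
    have := (hc.trans_le (hy i)).ne'
    field_simp
    ring
  rw [key, Finset.mul_sum]
  refine (Finset.abs_sum_le_sum_abs _ _).trans (Finset.sum_le_sum fun i _ => ?_)
  refine (abs_mul_log_taylor_le (hc.trans_le (hy i)) ((hu i).trans (by linarith [hy i]))).trans ?_
  have := hy i
  gcongr

lemma abs_freeEnergy_taylor_three_le {q : ℕ} [NeZero q] (β h : ℝ) {c : ℝ} (hc : 0 < c)
    {y u : Fin q → ℝ} (hy : ∀ i, c ≤ y i) (hu : ∀ i, |u i| ≤ c / 2) :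
    |freeEnergy q β h (y + u) - (freeEnergy q β h y + ∑ i, freeEnergyGrad q β h y i * u i
      + 1 / 2 * Qform q β y u)| ≤ 3 / c ^ 2 * ∑ i, |u i| ^ 3 := by
  have h4 := abs_freeEnergy_taylor_four_le β h hc hy hu
  have h3 : |∑ i, u i ^ 3 / (6 * y i ^ 2)| ≤ 1 / (6 * c ^ 2) * ∑ i, |u i| ^ 3 := by
    rw [Finset.mul_sum]
    refine (Finset.abs_sum_le_sum_abs _ _).trans (Finset.sum_le_sum fun i _ => ?_)
    have hyi := hy i
    have : 0 < y i := hc.trans_le hyi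
    rw [abs_div, abs_pow, abs_of_pos (show 0 < 6 * y i ^ 2 by positivity), div_eq_mul_one_div,
      mul_comm]
    gcongr
  have h5 : 4 / c ^ 3 * ∑ i, u i ^ 4 ≤ 2 / c ^ 2 * ∑ i, |u i| ^ 3 := by
    rw [Finset.mul_sum, Finset.mul_sum]
    refine Finset.sum_le_sum fun i _ => ?_
    have : u i ^ 4 = |u i| * |u i| ^ 3 := by
      rw [← pow_succ', show 3 + 1 = 2 * 2 from rfl, pow_mul, sq_abs, ← pow_mul]
    rw [this, ← mul_assoc]
    refine mul_le_mul_of_nonneg_right ?_ (by positivity)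
    calc 4 / c ^ 3 * |u i| ≤ 4 / c ^ 3 * (c / 2) := by gcongr; exact hu i
      _ = 2 / c ^ 2 := by field_simp; norm_num
  have h6 : 3 / c ^ 2 * ∑ i, |u i| ^ 3 = 1 / (6 * c ^ 2) * ∑ i, |u i| ^ 3
      + 2 / c ^ 2 * ∑ i, |u i| ^ 3 + 5 / (6 * c ^ 2) * ∑ i, |u i| ^ 3 := by
    field_simp; ring
  have h7 : 0 ≤ 5 / (6 * c ^ 2) * ∑ i, |u i| ^ 3 := by positivity
  rw [abs_le] at h3 h4 ⊢
  constructor <;> linarith [h3.1, h3.2, h4.1, h4.2]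

/-- Necessary conditions on the coefficients of a quartic that is nonnegative near `0`. -/
lemma coeff_of_eventually_nonneg {a b c K : ℝ}
    (H : ∀ᶠ τ in 𝓝 (0 : ℝ), 0 ≤ a * τ + b * τ ^ 2 + c * τ ^ 3 + K * τ ^ 4) :
    a = 0 ∧ 0 ≤ b ∧ (b = 0 → c = 0) := by
  have ha : a = 0 := by
    have hloc : IsLocalMin (fun τ : ℝ => a * τ + b * τ ^ 2 + c * τ ^ 3 + K * τ ^ 4) 0 := by
      filter_upwards [H] with τ hτ
      simpa using hτ
    have hder : HasDerivAt (fun τ : ℝ => a * τ + b * τ ^ 2 + c * τ ^ 3 + K * τ ^ 4) a 0 := by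
      have := ((((hasDerivAt_id (0 : ℝ)).const_mul a).add
        (((hasDerivAt_id (0 : ℝ)).pow 2).const_mul b)).add
        (((hasDerivAt_id (0 : ℝ)).pow 3).const_mul c)).add
        (((hasDerivAt_id (0 : ℝ)).pow 4).const_mul K)
      exact this.congr_deriv (by simp)
    exact hloc.hasDerivAt_eq_zero hder
  subst ha
  refine ⟨rfl, ?_, ?_⟩
  · have ht : Tendsto (fun τ : ℝ => b + c * τ + K * τ ^ 2) (𝓝[>] 0) (𝓝 b) := by
      have : Continuous fun τ : ℝ => b + c * τ + K * τ ^ 2 := by fun_prop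
      simpa using (this.tendsto 0).mono_left nhdsWithin_le_nhds
    refine ge_of_tendsto ht ?_
    filter_upwards [nhdsWithin_le_nhds H, self_mem_nhdsWithin] with τ hτ hpos
    have hpos : 0 < τ := hpos
    have : 0 ≤ τ ^ 2 * (b + c * τ + K * τ ^ 2) := by linarith
    exact nonneg_of_mul_nonneg_right this (by positivity)
  · rintro rfl
    have hcont : Continuous fun τ : ℝ => c + K * τ := by fun_prop
    apply le_antisymm
    · have ht : Tendsto (fun τ : ℝ => c + K * τ) (𝓝[<] 0) (𝓝 c) := by
        simpa using (hcont.tendsto 0).mono_left nhdsWithin_le_nhds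
      refine le_of_tendsto ht ?_
      filter_upwards [nhdsWithin_le_nhds H, self_mem_nhdsWithin] with τ hτ hneg
      have hneg : 0 < -τ := neg_pos.2 hneg
      have : 0 ≤ (-τ) ^ 3 * -(c + K * τ) := by linarith
      linarith [nonneg_of_mul_nonneg_right this (by positivity)]
    · have ht : Tendsto (fun τ : ℝ => c + K * τ) (𝓝[>] 0) (𝓝 c) := by
        simpa using (hcont.tendsto 0).mono_left nhdsWithin_le_nhds
      refine ge_of_tendsto ht ?_
      filter_upwards [nhdsWithin_le_nhds H, self_mem_nhdsWithin] with τ hτ hpos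
      have hpos : 0 < τ := hpos
      have : 0 ≤ τ ^ 3 * (c + K * τ) := by linarith
      exact nonneg_of_mul_nonneg_right this (by positivity)

lemma exists_pos_forall_le {q : ℕ} {y : Fin q → ℝ} (hy : ∀ i, 0 < y i) :
    ∃ c > 0, ∀ i, c ≤ y i := by
  rcases isEmpty_or_nonempty (Fin q) with he | hne
  · exact ⟨1, one_pos, fun i => (he.false i).elim⟩
  · obtain ⟨i, hi⟩ := Finite.exists_min y
    exact ⟨y i, hy i, hi⟩

/-- Conditions of order one, two and three at an interior local minimizer of the free energy. -/
lemma IsLocalMinOn.freeEnergy_conditions {q : ℕ} [NeZero q] {β h : ℝ} {y : Fin q → ℝ}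
    (hloc : IsLocalMinOn (freeEnergy q β h) (simplex q) y) (hys : ∑ i, y i = 1)
    (hy : ∀ i, 0 < y i) {w : Fin q → ℝ} (hw : ∑ i, w i = 0) :
    ∑ i, freeEnergyGrad q β h y i * w i = 0 ∧ 0 ≤ Qform q β y w ∧
      (Qform q β y w = 0 → ∑ i, w i ^ 3 / y i ^ 2 = 0) := by
  obtain ⟨c, hc, hcy⟩ := exists_pos_forall_le hy
  have hcont : Continuous fun τ : ℝ => y + τ • w := by fun_prop
  have hsmall : ∀ᶠ τ in 𝓝 (0 : ℝ), ∀ i, |(τ • w) i| ≤ c / 2 := by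
    rw [Filter.eventually_all]
    intro i
    have : Continuous fun τ : ℝ => |(τ • w) i| := by fun_prop
    have ht := this.tendsto 0
    simp only [zero_smul, Pi.zero_apply, abs_zero] at ht
    exact (ht.eventually_lt_const (half_pos hc)).mono fun _ h => h.le
  have hmem : ∀ᶠ τ in 𝓝 (0 : ℝ), y + τ • w ∈ simplex q := by
    filter_upwards [hsmall] with τ hτ
    refine ⟨fun i => ?_, ?_⟩
    · have := (abs_le.1 (hτ i)).1
      have := hcy i
      simp only [Pi.add_apply]; linarith
    · simp [Finset.sum_add_distrib, ← Finset.mul_sum, hw, hys]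
  have ht : Tendsto (fun τ : ℝ => y + τ • w) (𝓝 0) (𝓝[simplex q] y) := by
    refine tendsto_nhdsWithin_iff.2 ⟨?_, hmem⟩
    simpa using hcont.tendsto 0
  have hge := ht.eventually hloc
  have := coeff_of_eventually_nonneg (a := ∑ i, freeEnergyGrad q β h y i * w i)
    (b := 1 / 2 * Qform q β y w) (c := - (1 / 6 * ∑ i, w i ^ 3 / y i ^ 2))
    (K := 4 / c ^ 3 * ∑ i, w i ^ 4) (by
      filter_upwards [hge, hsmall] with τ h1 h2
      have h3 := (abs_le.1 (abs_freeEnergy_taylor_four_le β h hc hcy h2)).2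
      have e1 : ∑ i, freeEnergyGrad q β h y i * (τ • w) i =
          (∑ i, freeEnergyGrad q β h y i * w i) * τ := by
        rw [Finset.sum_mul]; refine Finset.sum_congr rfl fun i _ => ?_
        simp; ring
      have e2 : Qform q β y (τ • w) = Qform q β y w * τ ^ 2 := by
        simp only [Qform]
        rw [Finset.sum_mul]; refine Finset.sum_congr rfl fun i _ => ?_
        simp; ring
      have e3 : ∑ i, (τ • w) i ^ 3 / (6 * y i ^ 2) = 1 / 6 * (∑ i, w i ^ 3 / y i ^ 2) * τ ^ 3 := by
        rw [Finset.mul_sum, Finset.sum_mul]; refine Finset.sum_congr rfl fun i _ => ?_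
        have := (hy i).ne'
        simp; field_simp
      have e4 : ∑ i, (τ • w) i ^ 4 = (∑ i, w i ^ 4) * τ ^ 4 := by
        rw [Finset.sum_mul]; refine Finset.sum_congr rfl fun i _ => ?_
        simp; ring
      rw [e1, e2, e3, e4] at h3
      have h1 : freeEnergy q β h y ≤ freeEnergy q β h (y + τ • w) := h1
      linarith)
  refine ⟨this.1, by linarith [this.2.1], fun h0 => ?_⟩
  have := this.2.2 (by rw [h0, mul_zero])
  linarith

/-- A global minimizer of the free energy lies in the interior of the simplex. -/
lemma pos_of_isMinOn_freeEnergy {q : ℕ} [NeZero q] {β h : ℝ} (hβ : 0 ≤ β) (hh : 0 ≤ h)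
    {x : Fin q → ℝ} (hx : x ∈ simplex q) (hmin : IsMinOn (freeEnergy q β h) (simplex q) x)
    (i : Fin q) : 0 < x i := by
  by_contra hxi
  have hxi : x i = 0 := le_antisymm (not_lt.1 hxi) (hx.1 i)
  obtain ⟨j, hj⟩ : ∃ j, 0 < x j := by
    by_contra hcon
    push Not at hcon
    have : ∑ j, x j ≤ 0 := Finset.sum_nonpos fun j _ => hcon j
    linarith [hx.2]
  have hij : i ≠ j := by rintro rfl; exact hj.ne' hxi
  have hj1 : x j ≤ 1 := hx.2 ▸ Finset.single_le_sum (fun k _ => hx.1 k) (Finset.mem_univ j)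
  set τ : ℝ := x j * Real.exp (-(β + h + 1)) with hτ
  have hτ0 : 0 < τ := by positivity
  have hτj : τ < x j := by
    have : Real.exp (-(β + h + 1)) < 1 := by
      have := Real.exp_lt_exp.2 (show -(β + h + 1) < 0 by linarith)
      rwa [Real.exp_zero] at this
    nlinarith
  have hlogτ : Real.log τ = Real.log (x j) - (β + h + 1) := by
    rw [hτ, Real.log_mul hj.ne' (Real.exp_ne_zero _), Real.log_exp]; ring
  set y : Fin q → ℝ := Function.update (Function.update x i τ) j (x j - τ) with hy
  have hsum : ∀ g : Fin q → ℝ → ℝ, ∑ k, g k (y k) - ∑ k, g k (x k) =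
      (g i τ - g i 0) + (g j (x j - τ) - g j (x j)) := by
    intro g
    rw [← Finset.sum_sub_distrib, ← Finset.sum_subset (Finset.subset_univ {i, j})]
    · rw [Finset.sum_pair hij]; simp [hy, hij, hxi]
    · intro k _ hk
      simp only [Finset.mem_insert, Finset.mem_singleton, not_or] at hk
      simp [hy, hk.1, hk.2]
  have hys : y ∈ simplex q := by
    refine ⟨fun k => ?_, ?_⟩
    · by_cases hkj : k = j
      · subst hkj; simp only [hy, Function.update_self]; linarith
      · by_cases hki : k = i
        · subst hki; simp [hy, hkj, hτ0.le]
        · simp [hy, hkj, hki, hx.1 k]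
    · have := hsum fun _ t => t
      simp only [hx.2] at this
      linarith
  have hle : freeEnergy q β h x ≤ freeEnergy q β h y := hmin hys
  have h1 := hsum fun _ t => t * Real.log t
  have h2 := hsum fun _ t => t ^ 2
  have h3 := hsum fun k t => if k = 0 then t else 0
  simp only [Finset.sum_ite_eq', Finset.mem_univ, if_true] at h3
  have h4 : -τ ≤ y 0 - x 0 := by
    rw [h3]; split_ifs <;> linarith
  have h5 : (x j - τ) * Real.log (x j - τ) ≤ (x j - τ) * Real.log (x j) :=
    mul_le_mul_of_nonneg_left (Real.log_le_log (by linarith) (by linarith)) (by linarith)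
  have h6 : freeEnergy q β h y - freeEnergy q β h x
      = (τ * Real.log τ + ((x j - τ) * Real.log (x j - τ) - x j * Real.log (x j)))
        - β * (τ * (τ - x j)) - h * (y 0 - x 0) := by
    simp only [freeEnergy]
    linear_combination h1 - β / 2 * h2
  rw [hlogτ] at h6
  have h7 : -(β * (τ * (τ - x j))) ≤ β * τ := by
    have : τ * (x j - τ) ≤ τ * 1 := by gcongr; linarith
    nlinarith
  have h8 : -(h * (y 0 - x 0)) ≤ h * τ := by nlinarith
  nlinarith

/-- `x` takes a single value `t` off the index `k`, and satisfies there the relations that hold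
at a global minimizer of the free energy. -/
structure IsPottsMinimizer (q : ℕ) (β h : ℝ) (x : Fin q → ℝ) (k : Fin q) (t : ℝ) : Prop where
  pos : 0 < t
  pos' : 0 < x k
  eq_of_ne : ∀ j, j ≠ k → x j = t
  sum_eq : x k + ((q : ℝ) - 1) * t = 1
  mul_le_one : β * t ≤ 1
  eq_of_mul_eq_one : β * t = 1 → x k = t
  log_sub_log : Real.log (x k) - Real.log t - β * (x k - t) = h

lemma log_sub_mul_lt_log_sub_mul {β a b : ℝ} (ha : 0 < a) (hab : a < b) (hb : β * b ≤ 1) :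
    Real.log a - β * a < Real.log b - β * b := by
  have hb0 : 0 < b := ha.trans hab
  have h1 := Real.log_lt_sub_one_of_pos (div_pos ha hb0) (by
    rw [Ne, div_eq_one_iff_eq hb0.ne']; exact hab.ne)
  rw [Real.log_div ha.ne' hb0.ne'] at h1
  have h2 : β * (b - a) ≤ 1 - a / b := by
    rw [show 1 - a / b = (b - a) / b by field_simp, le_div_iff₀ hb0]
    nlinarith
  linarith

lemma exists_isPottsMinimizer {q : ℕ} [NeZero q] (hq : 2 ≤ q) {β h : ℝ} (hβ : 0 ≤ β)
    (hh : 0 ≤ h) {x : Fin q → ℝ} (hx : x ∈ simplex q)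
    (hmin : IsMinOn (freeEnergy q β h) (simplex q) x) :
    ∃ k t, IsPottsMinimizer q β h x k t := by
  have hpos := pos_of_isMinOn_freeEnergy hβ hh hx hmin
  have hpair : ∀ i j, i ≠ j → freeEnergyGrad q β h x i = freeEnergyGrad q β h x j ∧
      2 * β ≤ 1 / x i + 1 / x j := by
    intro i j hij
    set w : Fin q → ℝ := fun k => if k = i then 1 else if k = j then -1 else 0 with hw
    have hsum : ∀ g : Fin q → ℝ → ℝ, (∀ k, g k 0 = 0) → ∑ k, g k (w k) = g i 1 + g j (-1) := by
      intro g hg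
      rw [← Finset.sum_subset (Finset.subset_univ {i, j})]
      · rw [Finset.sum_pair hij]; simp [hw, hij.symm]
      · intro k _ hk
        simp only [Finset.mem_insert, Finset.mem_singleton, not_or] at hk
        simp [hw, hk.1, hk.2, hg]
    obtain ⟨h1, h2, -⟩ := hmin.localize.freeEnergy_conditions hx.2 hpos (w := w) (by
      rw [hsum (fun _ t => t) (fun _ => rfl)]; ring)
    rw [hsum (fun k t => freeEnergyGrad q β h x k * t) (fun _ => mul_zero _)] at h1
    simp only [Qform] at h2
    rw [hsum (fun k t => (1 / x k - β) * t ^ 2) (fun _ => by ring)] at h2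
    constructor <;> linarith
  have hmax : ∃ k, (∀ j, x j ≤ x k) ∧ (k = 0 ∨ h = 0) := by
    rcases hh.eq_or_lt with h0 | hpos'
    · obtain ⟨k, hk⟩ := Finite.exists_max x
      exact ⟨k, hk, Or.inr h0.symm⟩
    · refine ⟨0, fun j => ?_, Or.inl rfl⟩
      have hs : ∀ g : ℝ → ℝ, ∑ i, g ((x ∘ Equiv.swap 0 j) i) = ∑ i, g (x i) := fun g =>
        Equiv.sum_comp (Equiv.swap 0 j) fun i => g (x i)
      have hle : freeEnergy q β h x ≤ freeEnergy q β h (x ∘ Equiv.swap 0 j) :=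
        hmin ⟨fun i => hx.1 _, (hs fun t => t).trans hx.2⟩
      simp only [freeEnergy] at hle
      rw [hs fun t => t * Real.log t, hs fun t => t ^ 2] at hle
      simp only [Function.comp, Equiv.swap_apply_left] at hle
      exact le_of_mul_le_mul_left (by linarith) hpos'
  obtain ⟨k, hk, hk0⟩ := hmax
  have hfield : ∀ i, i ≠ k → (if i = 0 then h else 0) = 0 := by
    rintro i hi
    rcases hk0 with rfl | rfl
    · simp [hi]
    · simp
  have hfieldk : (if k = 0 then h else 0) = h := by
    rcases hk0 with rfl | rfl <;> simp
  have hle : ∀ i, i ≠ k → β * x i ≤ 1 := by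
    intro i hi
    have h1 := (hpair i k hi).2
    have h2 : 1 / x k ≤ 1 / x i := one_div_le_one_div_of_le (hpos i) (hk i)
    exact (le_div_iff₀ (hpos i)).1 (by linarith)
  have : Nontrivial (Fin q) := Fin.nontrivial_iff_two_le.2 hq
  obtain ⟨j, hj⟩ := exists_ne k
  have heq : ∀ i, i ≠ k → x i = x j := by
    intro i hi
    rcases eq_or_ne i j with rfl | hij
    · rfl
    have h1 := (hpair i j hij).1
    simp only [freeEnergyGrad, hfield i hi, hfield j hj] at h1
    rcases lt_trichotomy (x i) (x j) with hlt | he | hlt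
    · linarith [log_sub_mul_lt_log_sub_mul (hpos i) hlt (hle j hj)]
    · exact he
    · linarith [log_sub_mul_lt_log_sub_mul (hpos j) hlt (hle i hi)]
  refine ⟨k, x j, hpos j, hpos k, heq, ?_, hle j hj, fun h1 => ?_, ?_⟩
  · refine Eq.trans ?_ hx.2
    rw [← Finset.add_sum_erase _ _ (Finset.mem_univ k),
      Finset.sum_congr rfl fun i hi => heq i (Finset.ne_of_mem_erase hi)]
    have : 1 ≤ q := by omega
    simp [Finset.card_erase_of_mem, Nat.cast_sub this]
  · refine le_antisymm ?_ (hk j)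
    have h2 := (hpair k j hj.symm).2
    have h3 : 1 / x j = β := by rw [← h1]; field_simp [(hpos j).ne']
    have h4 : β ≤ 1 / x k := by linarith
    have := (le_div_iff₀ (hpos k)).1 h4
    have hβ0 : 0 < β := by rw [← h3]; exact one_div_pos.2 (hpos j)
    exact le_of_mul_le_mul_left (by linarith) hβ0
  · have h1 := (hpair k j hj.symm).1
    simp only [freeEnergyGrad, hfieldk, hfield j hj] at h1
    linarith

/-- At a global minimizer the Hessian is positive definite on the tangent space of the simplex,
except at the critical parameters `(β_0, h_0)`. -/
lemma exists_pos_mul_le_Qform {q : ℕ} [NeZero q] (hq : 2 ≤ q) {β h : ℝ} (hβ : 0 ≤ β)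
    (hh : 0 ≤ h) {x : Fin q → ℝ} (hx : x ∈ simplex q)
    (hmin : IsMinOn (freeEnergy q β h) (simplex q) x) (hne : (β, h) ≠ (beta0 q, h0 q)) :
    ∃ μ > 0, ∀ w : Fin q → ℝ, ∑ i, w i = 0 → μ * ∑ i, w i ^ 2 ≤ Qform q β x w := by
  have hpos := pos_of_isMinOn_freeEnergy hβ hh hx hmin
  obtain ⟨k, t, hP⟩ := exists_isPottsMinimizer hq hβ hh hx hmin
  have hq1 : (1 : ℝ) ≤ (q : ℝ) - 1 := by
    have : (2 : ℝ) ≤ q := by exact_mod_cast hq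
    linarith
  have hcard : ((Finset.univ.erase k).card : ℝ) = (q : ℝ) - 1 := by
    have : 1 ≤ q := by omega
    simp [Finset.card_erase_of_mem, Nat.cast_sub this]
  have hQ : ∀ w : Fin q → ℝ, Qform q β x w =
      (1 / x k - β) * w k ^ 2 + (1 / t - β) * ∑ j ∈ Finset.univ.erase k, w j ^ 2 := by
    intro w
    rw [Qform, ← Finset.add_sum_erase _ _ (Finset.mem_univ k), Finset.mul_sum]
    congr 1
    exact Finset.sum_congr rfl fun i hi => by rw [hP.eq_of_ne i (Finset.ne_of_mem_erase hi)]
  have ht := hP.pos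
  have hs := hP.pos'
  have hse := hP.sum_eq
  set m : ℝ := (q : ℝ) - 1 with hm
  have hqm : (q : ℝ) = m + 1 := by rw [hm]; ring
  set B : ℝ := 1 / t - β with hB
  set A : ℝ := (1 / x k - β) + B / m with hA
  have hm0 : 0 < m := by linarith
  set w₀ : Fin q → ℝ := fun i => if i = k then m else -1 with hw₀
  have hw₀e : ∀ i ∈ Finset.univ.erase k, w₀ i = -1 := fun i hi => by
    simp [hw₀, Finset.ne_of_mem_erase hi]
  have hw₀k : w₀ k = m := by simp [hw₀]
  obtain ⟨-, hQ0, hT⟩ := hmin.localize.freeEnergy_conditions hx.2 hpos (w := w₀) (by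
    rw [← Finset.add_sum_erase _ _ (Finset.mem_univ k), Finset.sum_congr rfl hw₀e, hw₀k]
    simp only [Finset.sum_const, nsmul_eq_mul, hcard]; ring)
  have hQw₀ : Qform q β x w₀ = m ^ 2 * A := by
    rw [hQ, hw₀k, Finset.sum_congr rfl fun i hi => by rw [hw₀e i hi]]
    simp only [Finset.sum_const, nsmul_eq_mul, hcard, hA]
    field_simp
  rw [hQw₀] at hQ0 hT
  have hA0 : A ≠ 0 := by
    intro hA0
    apply hne
    have hT := hT (by rw [hA0, mul_zero])
    have hTe : ∑ i, w₀ i ^ 3 / x i ^ 2 = m ^ 3 / x k ^ 2 - m / t ^ 2 := by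
      rw [← Finset.add_sum_erase _ _ (Finset.mem_univ k), hw₀k,
        Finset.sum_congr rfl fun i hi => by
          rw [hw₀e i hi, hP.eq_of_ne i (Finset.ne_of_mem_erase hi)]]
      simp only [Finset.sum_const, nsmul_eq_mul, hcard]
      ring
    rw [hTe] at hT
    have h1 : (m * t) ^ 2 = (x k) ^ 2 := by
      have e : m ^ 3 / x k ^ 2 - m / t ^ 2 = m * ((m * t) ^ 2 - x k ^ 2) / (x k ^ 2 * t ^ 2) := by
        field_simp
      rw [e, div_eq_zero_iff, mul_eq_zero] at hT
      rcases hT with (h | h) | h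
      · exact absurd h hm0.ne'
      · linarith
      · exact absurd h (by positivity)
    have h2 : m * t = x k := by
      have := (sq_eq_sq₀ (by positivity) hs.le).1 h1
      exact this
    have h3 : x k = 1 / 2 := by linarith
    have h4 : t = 1 / (2 * m) := by field_simp; linarith
    have hβe : β = beta0 q := by
      rw [hA, hB, h3, h4] at hA0
      rw [beta0, ← hm, hqm]
      field_simp at hA0 ⊢
      linarith
    refine Prod.ext hβe ?_
    have hlog := hP.log_sub_log
    rw [hβe, beta0, h3, h4, one_div (2 * m), Real.log_inv, Real.log_mul two_ne_zero hm0.ne',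
      one_div, Real.log_inv, ← hm] at hlog
    simp only [h0]
    rw [← hlog, ← hm, hqm]
    field_simp
    ring
  have hApos : 0 < A := lt_of_le_of_ne (nonneg_of_mul_nonneg_right hQ0 (by positivity)) hA0.symm
  have hBpos : 0 < B := by
    rcases hP.mul_le_one.lt_or_eq with hlt | heq
    · rw [hB, sub_pos, lt_div_iff₀ ht]; exact hlt
    · exfalso
      apply hA0
      have hβt : β = 1 / t := by field_simp; exact heq
      rw [hA, hB, hP.eq_of_mul_eq_one heq, hβt]
      ring
  refine ⟨min (A / 2) B, lt_min (by positivity) hBpos, fun w hw => ?_⟩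
  rw [hQ, ← Finset.add_sum_erase _ _ (Finset.mem_univ k)]
  rw [← Finset.add_sum_erase _ _ (Finset.mem_univ k)] at hw
  have hcs := sq_sum_le_card_mul_sum_sq (s := Finset.univ.erase k) (f := w)
  rw [hcard, show ∑ i ∈ Finset.univ.erase k, w i = - w k by linarith, neg_sq] at hcs
  set S := ∑ j ∈ Finset.univ.erase k, w j ^ 2 with hS
  have hexc : 0 ≤ S - w k ^ 2 / m := by
    rw [sub_nonneg, div_le_iff₀ hm0]; linarith
  have hdiv : w k ^ 2 / m ≤ w k ^ 2 := div_le_self (sq_nonneg _) hq1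
  have e1 : (1 / x k - β) * w k ^ 2 + B * S = A * w k ^ 2 + B * (S - w k ^ 2 / m) := by
    rw [hA]; field_simp; ring
  rw [e1]
  have hμ1 := min_le_left (A / 2) B
  have hμ2 := min_le_right (A / 2) B
  have hμ0 : 0 < min (A / 2) B := lt_min (by positivity) hBpos
  nlinarith [mul_le_mul_of_nonneg_right hμ1 (sq_nonneg (w k)),
    mul_le_mul_of_nonneg_right hμ2 hexc, mul_le_mul_of_nonneg_left hdiv hμ0.le]

lemma eventually_deriv_eq_zero {F F' : ℝ → ℝ} {t c : ℝ} (hF : ∀ᶠ u in 𝓝 t, F u = c)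
    (hF' : ∀ᶠ u in 𝓝 t, HasDerivAt F (F' u) u) : ∀ᶠ u in 𝓝 t, F' u = 0 := by
  filter_upwards [hF.eventually_nhds, hF'] with u h1 h2
  have h3 : F =ᶠ[𝓝 u] fun _ => c := h1
  exact h2.unique ((hasDerivAt_const u c).congr_of_eventuallyEq h3)

/-- The solutions `t` of the mean-field equation are isolated. -/
lemma eventually_meanField_ne {m t : ℝ} (β h : ℝ) (hm : 0 < m) (ht : 0 < t) (hs : 0 < 1 - m * t) :
    ∀ᶠ u in 𝓝[≠] t,
      Real.log (1 - m * u) - Real.log u - β * (1 - m * u - u) - h ≠ 0 := by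
  have han : AnalyticAt ℝ (fun u : ℝ =>
      Real.log (1 - m * u) - Real.log u - β * (1 - m * u - u) - h) t := by
    have hl1 : AnalyticAt ℝ (fun u : ℝ => Real.log (1 - m * u)) t :=
      AnalyticAt.log (by fun_prop) hs
    have hl2 : AnalyticAt ℝ (fun u : ℝ => Real.log u) t := AnalyticAt.log (by fun_prop) ht
    fun_prop
  refine han.eventually_eq_zero_or_eventually_ne_zero.resolve_left fun hz => ?_
  have hpos : ∀ᶠ u in 𝓝 t, 0 < u ∧ 0 < 1 - m * u := by
    refine (lt_mem_nhds ht).and ?_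
    have : Continuous fun u : ℝ => 1 - m * u := by fun_prop
    exact this.continuousAt.eventually (lt_mem_nhds hs)
  have h1 := eventually_deriv_eq_zero (F' := fun u => -m / (1 - m * u) - 1 / u + β * (m + 1)) hz (by
    filter_upwards [hpos] with u hu
    have hd : HasDerivAt (fun u : ℝ => 1 - m * u) (-m) u := by
      simpa using ((hasDerivAt_id u).const_mul m).const_sub 1
    have := (((hd.log hu.2.ne').sub ((hasDerivAt_id u).log hu.1.ne')).sub
      ((hd.sub (hasDerivAt_id u)).const_mul β)).sub_const h
    exact this.congr_deriv (by simp only [id]; ring))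
  have h2 : ∀ᶠ u in 𝓝 t, β * (m + 1) * (u - m * u ^ 2) = 1 := by
    filter_upwards [h1, hpos] with u hu hp
    have e1 := hp.1.ne'
    have e2 := hp.2.ne'
    field_simp at hu
    linarith
  have h3 := eventually_deriv_eq_zero (F' := fun u => β * (m + 1) * (1 - 2 * m * u)) h2 (by
    refine Eventually.of_forall fun u => ?_
    have := ((hasDerivAt_id u).sub (((hasDerivAt_id u).pow 2).const_mul m)).const_mul (β * (m + 1))
    exact this.congr_deriv (by simp only [id]; push_cast; ring))
  have h4 := eventually_deriv_eq_zero (F' := fun _ => β * (m + 1) * (-(2 * m))) h3 (by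
    refine Eventually.of_forall fun u => ?_
    have := (((hasDerivAt_id u).const_mul (2 * m)).const_sub 1).const_mul (β * (m + 1))
    exact this.congr_deriv (by simp))
  have h4 := h4.self_of_nhds
  have h2 := h2.self_of_nhds
  have : β * (m + 1) = 0 := by
    rcases mul_eq_zero.1 h4 with h | h
    · exact h
    · linarith
  rw [this, zero_mul] at h2
  exact zero_ne_one h2

/-- Global minimizers of the free energy are isolated. -/
lemma eventually_not_isMinOn_freeEnergy {q : ℕ} [NeZero q] (hq : 2 ≤ q) {β h : ℝ} (hβ : 0 ≤ β)
    (hh : 0 ≤ h) {x : Fin q → ℝ} (hx : x ∈ simplex q)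
    (hmin : IsMinOn (freeEnergy q β h) (simplex q) x) :
    ∀ᶠ y in 𝓝[≠] x, y ∈ simplex q → ¬ IsMinOn (freeEnergy q β h) (simplex q) y := by
  have hpos := pos_of_isMinOn_freeEnergy hβ hh hx hmin
  have hq1 : (0 : ℝ) < (q : ℝ) - 1 := by
    have : (2 : ℝ) ≤ q := by exact_mod_cast hq
    linarith
  have key : ∀ k, ∀ᶠ y in 𝓝[≠] x, ∀ t, ¬ IsPottsMinimizer q β h y k t := by
    intro k
    by_cases hk : ∃ i j, i ≠ k ∧ j ≠ k ∧ x i ≠ x j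
    · obtain ⟨i, j, hi, hj, hij⟩ := hk
      have hc : ∀ᶠ y : Fin q → ℝ in 𝓝 x, y i ≠ y j :=
        (isOpen_ne_fun (continuous_apply i) (continuous_apply j)).mem_nhds hij
      filter_upwards [nhdsWithin_le_nhds hc] with y hy t hP
      exact hy ((hP.eq_of_ne i hi).trans (hP.eq_of_ne j hj).symm)
    · push Not at hk
      have : Nontrivial (Fin q) := Fin.nontrivial_iff_two_le.2 hq
      obtain ⟨j, hj⟩ := exists_ne k
      have hxk : x k + ((q : ℝ) - 1) * x j = 1 := by
        refine Eq.trans ?_ hx.2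
        rw [← Finset.add_sum_erase _ _ (Finset.mem_univ k),
          Finset.sum_congr rfl fun i hi => hk i j (Finset.ne_of_mem_erase hi) hj]
        have : 1 ≤ q := by omega
        simp [Finset.card_erase_of_mem, Nat.cast_sub this]
      have hG := eventually_meanField_ne β h hq1 (hpos j) (by linarith [hpos k])
      rw [eventually_nhdsWithin_iff] at hG
      have hG' := (continuous_apply j).continuousAt.eventually hG
      filter_upwards [nhdsWithin_le_nhds hG', self_mem_nhdsWithin] with y hy hne t hP
      have hyj : y j = t := hP.eq_of_ne j hj
      have hyk : y k = 1 - ((q : ℝ) - 1) * t := by linarith [hP.sum_eq]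
      have hne' : y j ∈ ({x j}ᶜ : Set ℝ) := by
        intro hyx
        have hyx : y j = x j := hyx
        apply hne
        funext i
        by_cases hi : i = k
        · subst hi; rw [hyk, ← hyj, hyx]; linarith
        · rw [hP.eq_of_ne i hi, ← hyj, hyx, hk i j hi hj]
      apply hy hne'
      rw [hyj, ← hyk]
      linarith [hP.log_sub_log]
  filter_upwards [Filter.eventually_all.2 key] with y hy hys hymin
  obtain ⟨k, t, hP⟩ := exists_isPottsMinimizer hq hβ hh hys hymin
  exact hy k t hP

lemma continuous_freeEnergy (q : ℕ) [NeZero q] (β h : ℝ) : Continuous (freeEnergy q β h) := by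
  unfold freeEnergy
  have : ∀ i : Fin q, Continuous fun x : Fin q → ℝ => x i * Real.log (x i) := fun i =>
    Real.continuous_mul_log.comp (continuous_apply i)
  fun_prop

lemma abs_freeEnergy_sub_le {q : ℕ} [NeZero q] (β h β' h' : ℝ) {y : Fin q → ℝ}
    (hy : y ∈ simplex q) :
    |freeEnergy q β' h' y - freeEnergy q β h y| ≤ |β' - β| + |h' - h| := by
  have h1 : ∀ i, y i ≤ 1 := fun i =>
    hy.2 ▸ Finset.single_le_sum (fun k _ => hy.1 k) (Finset.mem_univ i)
  have h2 : ∑ i, y i ^ 2 ≤ 1 := by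
    rw [← hy.2]
    exact Finset.sum_le_sum fun i _ => by nlinarith [h1 i, hy.1 i]
  have h3 : 0 ≤ ∑ i, y i ^ 2 := by positivity
  have e : freeEnergy q β' h' y - freeEnergy q β h y
      = -((β' - β) * ((∑ i, y i ^ 2) / 2)) - (h' - h) * y 0 := by
    simp only [freeEnergy]; ring
  rw [e]
  refine (abs_sub _ _).trans (add_le_add ?_ ?_)
  · rw [abs_neg, abs_mul]
    refine mul_le_of_le_one_right (abs_nonneg _) ?_
    rw [abs_of_nonneg (by positivity)]; linarith
  · rw [abs_mul]
    refine mul_le_of_le_one_right (abs_nonneg _) ?_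
    rw [abs_of_nonneg (hy.1 0)]; exact h1 0

/-- Local minimizers persist near an isolated global minimizer under small perturbations of the
parameters. -/
lemma eventually_exists_isLocalMinOn_freeEnergy {q : ℕ} [NeZero q] {β h : ℝ}
    {βseq hseq : ℕ → ℝ} (hβs : Tendsto βseq atTop (𝓝 β)) (hhs : Tendsto hseq atTop (𝓝 h))
    {x : Fin q → ℝ} (hx : x ∈ simplex q) (hmin : IsMinOn (freeEnergy q β h) (simplex q) x)
    (hiso : ∀ᶠ y in 𝓝[≠] x, y ∈ simplex q → ¬ IsMinOn (freeEnergy q β h) (simplex q) y)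
    {δ : ℝ} (hδ : 0 < δ) :
    ∀ᶠ n in atTop, ∃ y ∈ simplex q,
      IsLocalMinOn (freeEnergy q (βseq n) (hseq n)) (simplex q) y ∧ dist y x < δ := by
  have hcompact : IsCompact (simplex q) := isCompact_stdSimplex ℝ (Fin q)
  rw [eventually_nhdsWithin_iff, Metric.eventually_nhds_iff] at hiso
  obtain ⟨r, hr, hiso⟩ := hiso
  set ρ : ℝ := min (r / 2) (δ / 2) with hρ
  have hρ0 : 0 < ρ := lt_min (by positivity) (by positivity)
  have hρr : ρ < r := (min_le_left _ _).trans_lt (by linarith)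
  have hρδ : ρ < δ := (min_le_right _ _).trans_lt (by linarith)
  obtain ⟨η, hη, hgap⟩ : ∃ η > 0, ∀ z ∈ simplex q ∩ Metric.sphere x ρ,
      freeEnergy q β h x + η ≤ freeEnergy q β h z := by
    rcases (simplex q ∩ Metric.sphere x ρ).eq_empty_or_nonempty with he | hne
    · exact ⟨1, one_pos, fun z hz => by rw [he] at hz; exact hz.elim⟩
    · obtain ⟨z, hz, hzmin⟩ := (hcompact.inter_right Metric.isClosed_sphere).exists_isMinOn hne
        (continuous_freeEnergy q β h).continuousOn
      refine ⟨freeEnergy q β h z - freeEnergy q β h x, ?_, fun y hy => ?_⟩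
      · have hzx : dist z x = ρ := hz.2
        have hnot := hiso (hzx.trans_lt hρr) (dist_pos.1 (hzx ▸ hρ0)) hz.1
        by_contra hcon
        refine hnot fun y hy => ?_
        have h1 : freeEnergy q β h x ≤ freeEnergy q β h y := hmin hy
        change freeEnergy q β h z ≤ freeEnergy q β h y
        linarith
      · have : freeEnergy q β h z ≤ freeEnergy q β h y := hzmin hy
        linarith
  have herr : Tendsto (fun n => |βseq n - β| + |hseq n - h|) atTop (𝓝 0) := by
    simpa using ((hβs.sub_const β).abs).add ((hhs.sub_const h).abs)
  filter_upwards [herr.eventually_lt_const (half_pos hη)] with n hn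
  obtain ⟨y, hy, hymin⟩ := (hcompact.inter_right Metric.isClosed_closedBall).exists_isMinOn
    ⟨x, hx, Metric.mem_closedBall_self hρ0.le⟩
    (continuous_freeEnergy q (βseq n) (hseq n)).continuousOn
  have hlt : dist y x < ρ := by
    refine lt_of_le_of_ne hy.2 fun he => ?_
    have h1 := hgap y ⟨hy.1, he⟩
    have h2 : freeEnergy q (βseq n) (hseq n) y ≤ freeEnergy q (βseq n) (hseq n) x :=
      hymin ⟨hx, Metric.mem_closedBall_self hρ0.le⟩
    have h3 := abs_le.1 (abs_freeEnergy_sub_le β h (βseq n) (hseq n) hy.1)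
    have h4 := abs_le.1 (abs_freeEnergy_sub_le β h (βseq n) (hseq n) hx)
    linarith [h3.1, h4.2]
  refine ⟨y, hy.1, ?_, hlt.trans hρδ⟩
  have hnb : Metric.closedBall x ρ ∈ 𝓝[simplex q] y := nhdsWithin_le_nhds
    (Filter.mem_of_superset (Metric.isOpen_ball.mem_nhds hlt) Metric.ball_subset_closedBall)
  filter_upwards [hnb, self_mem_nhdsWithin] with z h1 h2
  exact hymin ⟨h2, h1⟩

lemma sq_le_sum_sq {q : ℕ} (w : Fin q → ℝ) (i : Fin q) : w i ^ 2 ≤ ∑ j, w j ^ 2 :=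
  Finset.single_le_sum (f := fun j => w j ^ 2) (fun _ _ => sq_nonneg _) (Finset.mem_univ i)

/-- A displacement of minimal norm to a local minimizer of the perturbed free energy tends to
zero. -/
lemma tendsto_zero_of_minimal_displacement {q : ℕ} [NeZero q] {β h : ℝ}
    {βseq hseq : ℕ → ℝ} (hβs : Tendsto βseq atTop (𝓝 β)) (hhs : Tendsto hseq atTop (𝓝 h))
    {x : Fin q → ℝ} (hx : x ∈ simplex q) (hmin : IsMinOn (freeEnergy q β h) (simplex q) x)
    (hiso : ∀ᶠ y in 𝓝[≠] x, y ∈ simplex q → ¬ IsMinOn (freeEnergy q β h) (simplex q) y)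
    {d : ℕ → Fin q → ℝ}
    (hd : ∀ n, ∀ d' : Fin q → ℝ, (∑ i, d' i = 0) → (x + d') ∈ simplex q →
        IsLocalMinOn (freeEnergy q (βseq n) (hseq n)) (simplex q) (x + d') →
        ∑ i, (d n i) ^ 2 ≤ ∑ i, (d' i) ^ 2) :
    Tendsto d atTop (𝓝 0) := by
  rw [tendsto_pi_nhds]
  intro i
  have hq0 : (0 : ℝ) < q := by exact_mod_cast Nat.pos_of_ne_zero (NeZero.ne q)
  rw [Metric.tendsto_atTop']
  intro δ hδ
  have hev := eventually_exists_isLocalMinOn_freeEnergy hβs hhs hx hmin hiso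
    (show 0 < δ / (2 * Real.sqrt q) by positivity)
  obtain ⟨N, hN⟩ := eventually_atTop.1 hev
  refine ⟨N, fun n hn => ?_⟩
  obtain ⟨y, hy, hyloc, hyx⟩ := hN n hn.le
  have hle := hd n (y - x) (by simp [Finset.sum_sub_distrib, hy.2, hx.2]) (by simpa using hy)
    (by simpa using hyloc)
  have hb : ∑ i, (y - x) i ^ 2 ≤ ∑ _i : Fin q, (δ / (2 * Real.sqrt q)) ^ 2 := by
    refine Finset.sum_le_sum fun j _ => ?_
    have := (dist_le_pi_dist y x j).trans hyx.le
    rw [Real.dist_eq] at this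
    rw [Pi.sub_apply, ← sq_abs]
    gcongr
  have he : ∑ _i : Fin q, (δ / (2 * Real.sqrt q)) ^ 2 = (δ / 2) ^ 2 := by
    simp only [Finset.sum_const, Finset.card_univ, Fintype.card_fin, nsmul_eq_mul]
    rw [div_pow, mul_pow, Real.sq_sqrt hq0.le]
    field_simp
  have h1 : (d n i) ^ 2 ≤ (δ / 2) ^ 2 := (sq_le_sum_sq _ i).trans (hle.trans (hb.trans he.le))
  have h2 := abs_le_of_sq_le_sq h1 (by positivity)
  rw [Pi.zero_apply, Real.dist_eq, sub_zero]
  linarith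

/-- Rescaled Taylor expansion at a point where the gradient vanishes on the tangent space. -/
lemma abs_rescaled_freeEnergy_le {q : ℕ} [NeZero q] (β h : ℝ) {c ρ s N : ℝ} (hc : 0 < c)
    (hρ : ρ ≤ c / 2) (hN : 0 ≤ N) (hNs : N * s ^ 2 = 1) {y w : Fin q → ℝ} (hy : ∀ i, c ≤ y i)
    (hgrad : ∑ i, freeEnergyGrad q β h y i * w i = 0) (hw : ∀ i, |s * w i| ≤ ρ) :
    |N * freeEnergy q β h (y + s • w) - (N * freeEnergy q β h y + 1 / 2 * Qform q β y w)|
      ≤ 3 / c ^ 2 * ρ * ∑ i, w i ^ 2 := by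
  have h3 := abs_freeEnergy_taylor_three_le β h hc (u := s • w) hy fun i => by
    simpa using (hw i).trans hρ
  have e1 : ∑ i, freeEnergyGrad q β h y i * (s • w) i = 0 := by
    rw [← mul_zero s, ← hgrad, Finset.mul_sum]
    exact Finset.sum_congr rfl fun i _ => by simp; ring
  have e2 : Qform q β y (s • w) = s ^ 2 * Qform q β y w := by
    simp only [Qform]
    rw [Finset.mul_sum]
    exact Finset.sum_congr rfl fun i _ => by simp; ring
  have e3 : ∑ i, |(s • w) i| ^ 3 ≤ ρ * s ^ 2 * ∑ i, w i ^ 2 := by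
    rw [Finset.mul_sum]
    refine Finset.sum_le_sum fun i _ => ?_
    have : |(s • w) i| ^ 3 = |s * w i| * (s ^ 2 * w i ^ 2) := by
      rw [← mul_pow, ← sq_abs (s * w i)]; simp; ring
    rw [this, mul_assoc]
    exact mul_le_mul_of_nonneg_right (hw i) (by positivity)
  rw [e1, e2] at h3
  have h4 : N * freeEnergy q β h (y + s • w) - (N * freeEnergy q β h y + 1 / 2 * Qform q β y w)
      = N * (freeEnergy q β h (y + s • w)
        - (freeEnergy q β h y + 0 + 1 / 2 * (s ^ 2 * Qform q β y w))) := by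
    linear_combination (1 / 2 * Qform q β y w) * hNs
  rw [h4, abs_mul, abs_of_nonneg hN]
  calc _ ≤ N * (3 / c ^ 2 * (ρ * s ^ 2 * ∑ i, w i ^ 2)) := by
        refine mul_le_mul_of_nonneg_left (h3.trans ?_) hN
        gcongr
    _ = (N * s ^ 2) * (3 / c ^ 2 * ρ * ∑ i, w i ^ 2) := by ring
    _ = _ := by rw [hNs, one_mul]

lemma abs_Qform_sub_le {q : ℕ} (β β' : ℝ) (x y w : Fin q → ℝ) :
    |Qform q β' y w - Qform q β x w| ≤
      (∑ i, |(1 / y i - β') - (1 / x i - β)|) * ∑ i, w i ^ 2 := by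
  rw [Qform, Qform, ← Finset.sum_sub_distrib, Finset.sum_mul]
  refine (Finset.abs_sum_le_sum_abs _ _).trans (Finset.sum_le_sum fun i _ => ?_)
  rw [← sub_mul, abs_mul, abs_of_nonneg (sq_nonneg (w i))]
  exact mul_le_mul_of_nonneg_left (sq_le_sum_sq w i) (abs_nonneg _)

/-- uniform second order Taylor expansion of `n f_{β_n,h_n}` around the
recentered minimizer `x + d_n`, and quadratic lower bound when `(β,h) ≠ (β_0,h_0)`. -/
theorem stmt_12 (q : ℕ) [NeZero q] (hq : 2 ≤ q) (β h : ℝ) (hβ : 0 ≤ β) (hh : 0 ≤ h)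
    (βseq hseq : ℕ → ℝ)
    (hβs : Tendsto βseq atTop (𝓝 β)) (hhs : Tendsto hseq atTop (𝓝 h))
    (x : Fin q → ℝ) (hx : x ∈ simplex q)
    (hmin : ∀ y ∈ simplex q, freeEnergy q β h x ≤ freeEnergy q β h y)
    (d : ℕ → Fin q → ℝ)
    (hd : ∀ n : ℕ, (∑ i, d n i = 0) ∧ (x + d n) ∈ simplex q ∧
      IsLocalMinOn (freeEnergy q (βseq n) (hseq n)) (simplex q) (x + d n) ∧
      ∀ d' : Fin q → ℝ, (∑ i, d' i = 0) → (x + d') ∈ simplex q →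
        IsLocalMinOn (freeEnergy q (βseq n) (hseq n)) (simplex q) (x + d') →
        ∑ i, (d n i) ^ 2 ≤ ∑ i, (d' i) ^ 2) :
    (∀ R > (0 : ℝ), ∀ ε > (0 : ℝ), ∃ n₀ : ℕ, ∀ n ≥ n₀, ∀ w : Fin q → ℝ,
      (∑ i, w i = 0) → (∑ i, (w i) ^ 2 ≤ R ^ 2) →
      |(n : ℝ) * freeEnergy q (βseq n) (hseq n)
            (x + d n + ((n : ℝ) ^ (-(1 / 2 : ℝ))) • w)
          - ((n : ℝ) * freeEnergy q (βseq n) (hseq n) (x + d n)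
              + 1 / 2 * Qform q β x w)| ≤ ε) ∧
    ((β, h) ≠ (beta0 q, h0 q) →
      ∃ ε₀ > (0 : ℝ), ∀ ε : ℝ, 0 < ε → ε ≤ ε₀ → ∃ lam > (0 : ℝ), ∃ n₀ : ℕ,
        ∀ n ≥ n₀, ∀ w : Fin q → ℝ, (∑ i, w i = 0) → (∑ i, (w i) ^ 2 ≤ ε ^ 2 * n) →
          (n : ℝ) * freeEnergy q (βseq n) (hseq n) (x + d n)
              + lam * ∑ i, (w i) ^ 2
            ≤ (n : ℝ) * freeEnergy q (βseq n) (hseq n)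
                (x + d n + ((n : ℝ) ^ (-(1 / 2 : ℝ))) • w)) := by
  have hmin' : IsMinOn (freeEnergy q β h) (simplex q) x := hmin
  have hpos := pos_of_isMinOn_freeEnergy hβ hh hx hmin'
  have hd0 : Tendsto d atTop (𝓝 0) := tendsto_zero_of_minimal_displacement hβs hhs hx hmin'
    (eventually_not_isMinOn_freeEnergy hq hβ hh hx hmin') fun n => (hd n).2.2.2
  have hy : Tendsto (fun n => x + d n) atTop (𝓝 x) := by simpa using hd0.const_add x
  have hyi : ∀ i, Tendsto (fun n => (x + d n) i) atTop (𝓝 (x i)) := tendsto_pi_nhds.1 hy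
  obtain ⟨c', hc', hcx⟩ := exists_pos_forall_le hpos
  obtain ⟨c, hc, hcc'⟩ : ∃ c > 0, c < c' := ⟨c' / 2, by positivity, by linarith⟩
  have hcy : ∀ᶠ n in atTop, ∀ i, c ≤ (x + d n) i := by
    rw [Filter.eventually_all]
    exact fun i => ((hyi i).eventually_const_lt (hcc'.trans_le (hcx i))).mono fun n hn => hn.le
  have hcoef : Tendsto (fun n => ∑ i, |(1 / (x + d n) i - βseq n) - (1 / x i - β)|) atTop
      (𝓝 0) := by
    have : Tendsto (fun n => ∑ i, |(1 / (x + d n) i - βseq n) - (1 / x i - β)|) atTop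
        (𝓝 (∑ i, |(1 / x i - β) - (1 / x i - β)|)) := tendsto_finsetSum _ fun i _ =>
      (((tendsto_const_nhds.div (hyi i) (hpos i).ne').sub hβs).sub_const _).abs
    simpa using this
  have hs0 : Tendsto (fun n : ℕ => (n : ℝ) ^ (-(1 / 2 : ℝ))) atTop (𝓝 0) :=
    (tendsto_rpow_neg_atTop (by norm_num)).comp tendsto_natCast_atTop_atTop
  have hNs : ∀ᶠ n : ℕ in atTop, (n : ℝ) * ((n : ℝ) ^ (-(1 / 2 : ℝ))) ^ 2 = 1 := by
    filter_upwards [eventually_gt_atTop 0] with n hn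
    have hn0 : (0 : ℝ) < n := by exact_mod_cast hn
    rw [← Real.rpow_natCast, ← Real.rpow_mul hn0.le]
    norm_num
    rw [Real.rpow_neg_one, mul_inv_cancel₀ hn0.ne']
  have hgrad : ∀ᶠ n in atTop, ∀ w : Fin q → ℝ, ∑ i, w i = 0 →
      ∑ i, freeEnergyGrad q (βseq n) (hseq n) (x + d n) i * w i = 0 := by
    filter_upwards [hcy] with n hn w hw
    exact ((hd n).2.2.1.freeEnergy_conditions (hd n).2.1.2 (fun i => hc.trans_le (hn i)) hw).1
  refine ⟨fun R hR ε hε => ?_, fun hne => ?_⟩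
  · have hcoefR := (hcoef.mul_const (R ^ 2)).eventually_lt_const (u := ε) (by simpa using hε)
    have hsR : ∀ᶠ n : ℕ in atTop, (n : ℝ) ^ (-(1 / 2 : ℝ)) * R < c / 2 :=
      (hs0.mul_const R).eventually_lt_const (by simpa using hc)
    have hrem : ∀ᶠ n : ℕ in atTop,
        3 / c ^ 2 * ((n : ℝ) ^ (-(1 / 2 : ℝ)) * R) * R ^ 2 < ε / 2 :=
      (((hs0.mul_const R).const_mul (3 / c ^ 2)).mul_const (R ^ 2)).eventually_lt_const
        (by simpa using hε)
    refine eventually_atTop.1 ?_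
    filter_upwards [hcy, hNs, hgrad, hcoefR, hsR, hrem] with n h1 h2 h3 h4 h5 h6 w hw hwR
    set s : ℝ := (n : ℝ) ^ (-(1 / 2 : ℝ)) with hs
    have hs_nonneg : 0 ≤ s := by positivity
    have hT := abs_rescaled_freeEnergy_le (βseq n) (hseq n) (w := w) hc h5.le n.cast_nonneg h2 h1
      (h3 w hw) fun i => by
        rw [abs_mul, abs_of_nonneg hs_nonneg]
        exact mul_le_mul_of_nonneg_left
          (abs_le_of_sq_le_sq ((sq_le_sum_sq w i).trans hwR) hR.le) hs_nonneg
    have hQ := abs_Qform_sub_le β (βseq n) x (x + d n) w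
    have hT' : 3 / c ^ 2 * (s * R) * ∑ i, w i ^ 2 ≤ 3 / c ^ 2 * (s * R) * R ^ 2 :=
      mul_le_mul_of_nonneg_left hwR (by positivity)
    have hQ' := mul_le_mul_of_nonneg_left hwR
      (show 0 ≤ ∑ i, |(1 / (x + d n) i - βseq n) - (1 / x i - β)| by positivity)
    rw [abs_le] at hT hQ ⊢
    constructor <;> linarith [hT.1, hT.2, hQ.1, hQ.2]
  · obtain ⟨μ, hμ, hμQ⟩ := exists_pos_mul_le_Qform hq hβ hh hx hmin' hne
    refine ⟨min (c / 2) (c ^ 2 * μ / 24), by positivity, fun ε hε hεle =>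
      ⟨μ / 8, by positivity, eventually_atTop.1 ?_⟩⟩
    filter_upwards [hcy, hNs, hgrad, hcoef.eventually_lt_const (half_pos hμ)]
      with n h1 h2 h3 h4 w hw hwε
    set s : ℝ := (n : ℝ) ^ (-(1 / 2 : ℝ)) with hs
    have hT := abs_rescaled_freeEnergy_le (βseq n) (hseq n) (w := w) (ρ := ε) hc
      (hεle.trans (min_le_left _ _)) n.cast_nonneg h2 h1 (h3 w hw) fun i => by
        refine abs_le_of_sq_le_sq ?_ hε.le
        calc (s * w i) ^ 2 ≤ s ^ 2 * (ε ^ 2 * n) := by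
              rw [mul_pow]
              exact mul_le_mul_of_nonneg_left ((sq_le_sum_sq w i).trans hwε) (sq_nonneg s)
          _ = ε ^ 2 * (n * s ^ 2) := by ring
          _ = ε ^ 2 := by rw [h2, mul_one]
    have hQ := abs_Qform_sub_le β (βseq n) x (x + d n) w
    have hW : 0 ≤ ∑ i, w i ^ 2 := by positivity
    have hT' : 3 / c ^ 2 * ε * ∑ i, w i ^ 2 ≤ μ / 8 * ∑ i, w i ^ 2 := by
      refine mul_le_mul_of_nonneg_right ?_ hW
      calc 3 / c ^ 2 * ε ≤ 3 / c ^ 2 * (c ^ 2 * μ / 24) := by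
            gcongr; exact hεle.trans (min_le_right _ _)
        _ = μ / 8 := by field_simp; norm_num
    have hQ' := mul_le_mul_of_nonneg_right h4.le hW
    have hpd := hμQ w hw
    rw [abs_le] at hT hQ
    linarith [hT.1, hQ.1]
end
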